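/- arXiv:2104.01480 — 6 statements merged into one kernel-verified Lean document; each statement's English description precedes it below -/
import Mathlib

section
/- (Non-degeneracy of the dispersionless spectrum.) For every integer w ≥ 0 there exists an integer m = m(w) ≥ 0 such that for all partitions λ ≠ μ with |λ| = |μ| = w, the two-variable polynomials E_m^{[0]}(λ) := Σ_{j=0}^{m+2} X^j Y^{m+2−j} Q_j(λ)/(m+2−j)! and E_m^{[0]}(μ) := Σ_{j=0}^{m+2} X^j Y^{m+2−j} Q_j(μ)/(m+2−j)!, regarded as elements of ℚ[X,Y], are distinct. -/
/-- A partition `λ = (λ_1, λ_2, …)`: a non-increasing sequence of non-negative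
integers with finitely many nonzero parts.  `parts i` is the part `λ_{i+1}`. -/
structure Ptn where
  parts : ℕ → ℕ
  antitone : ∀ ⦃i j : ℕ⦄, i ≤ j → parts j ≤ parts i
  eventually_zero : ∃ N : ℕ, ∀ i : ℕ, N ≤ i → parts i = 0

/-- The weight `|λ| = Σ_i λ_i`. -/
noncomputable def Ptn.wt (lam : Ptn) : ℕ := ∑ᶠ i : ℕ, lam.parts i

/-- `P_j(λ) = Σ_{i=1}^{ℓ(λ)} [(λ_i − i + 1/2)^j − (−i + 1/2)^j]`; the terms with
`λ_i = 0` vanish, so the (finitely supported) sum over all `i ≥ 1` agrees with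
the sum over `1 ≤ i ≤ ℓ(λ)`. -/
noncomputable def Pfn (j : ℕ) (lam : Ptn) : ℚ :=
  ∑ᶠ i : ℕ, (((lam.parts i : ℚ) - ((i : ℚ) + 1) + 1 / 2) ^ j - (-((i : ℚ) + 1) + 1 / 2) ^ j)

/-- `Q_0(λ) = 1` and, for `j ≥ 1`, `Q_j(λ) = P_{j−1}(λ)/(j−1)! + β_j`, where
`β_j = (2^{1−j} − 1) B_j / j!` with `B_j` the `j`-th Bernoulli number. -/
noncomputable def Qfn (j : ℕ) (lam : Ptn) : ℚ :=
  if j = 0 then 1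
  else Pfn (j - 1) lam / (Nat.factorial (j - 1) : ℚ) +
    ((2 : ℚ) ^ ((1 : ℤ) - (j : ℤ)) - 1) * bernoulli j / (Nat.factorial j : ℚ)

/-- The two-variable polynomial
`E_m^{[0]}(λ) = Σ_{j=0}^{m+2} X^j Y^{m+2−j} Q_j(λ)/(m+2−j)! ∈ ℚ[X,Y]`,
where `X = X 0` plays the role of `√ℏ` and `Y = X 1` that of `U_0`. -/
noncomputable def Epoly (m : ℕ) (lam : Ptn) : MvPolynomial (Fin 2) ℚ :=
  ∑ j ∈ Finset.range (m + 3),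
    MvPolynomial.C (Qfn j lam / (Nat.factorial (m + 2 - j) : ℚ)) *
      MvPolynomial.X 0 ^ j * MvPolynomial.X 1 ^ (m + 2 - j)

lemma Ptn.parts_zero (lam : Ptn) (w : ℕ) (h : lam.wt = w) (i : ℕ) (hi : w ≤ i) :
    lam.parts i = 0 := by
  by_contra hne
  obtain ⟨N, hN⟩ := lam.eventually_zero
  have hsupp : Function.support lam.parts ⊆ ((Finset.range (N + i + 1) : Finset ℕ) : Set ℕ) := by
    intro k hk
    simp only [Finset.coe_range, Set.mem_Iio]
    by_contra hk2
    exact hk (hN k (by omega))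
  have h1 : lam.wt = ∑ k ∈ Finset.range (N + i + 1), lam.parts k :=
    finsum_eq_sum_of_support_subset _ hsupp
  have h2 : ∑ k ∈ Finset.range (i + 1), lam.parts k ≤ ∑ k ∈ Finset.range (N + i + 1), lam.parts k :=
    Finset.sum_le_sum_of_subset (Finset.range_subset_range.2 (by omega))
  have h3 : ∑ k ∈ Finset.range (i + 1), 1 ≤ ∑ k ∈ Finset.range (i + 1), lam.parts k := by
    apply Finset.sum_le_sum
    intro k hk
    have := lam.antitone (show k ≤ i by simp at hk; omega)
    omega
  simp at h3
  omega

/-- shifted parts -/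
def Ptn.sh (lam : Ptn) (i : ℕ) : ℚ := (lam.parts i : ℚ) - ((i : ℚ) + 1) + 1 / 2

lemma Ptn.sh_lt (lam : Ptn) {i j : ℕ} (h : i < j) : lam.sh j < lam.sh i := by
  have h1 : (lam.parts j : ℚ) ≤ lam.parts i := by exact_mod_cast lam.antitone h.le
  have h2 : (i : ℚ) < j := by exact_mod_cast h
  unfold Ptn.sh
  linarith

lemma Pfn_eq (lam : Ptn) (w : ℕ) (h : lam.wt = w) (j : ℕ) :
    Pfn j lam = ∑ i ∈ Finset.range w, lam.sh i ^ j
      - ∑ i ∈ Finset.range w, (-((i : ℚ) + 1) + 1 / 2) ^ j := by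
  rw [← Finset.sum_sub_distrib]
  apply finsum_eq_sum_of_support_subset
  intro k hk
  simp only [Finset.coe_range, Set.mem_Iio]
  by_contra hk2
  apply hk
  simp only [lam.parts_zero w h k (by omega)]
  simp

lemma Epoly_coeff (m : ℕ) (lam mu : Ptn) (h : Epoly m lam = Epoly m mu) (j : ℕ) (hj : j < m + 2) :
    Pfn j lam = Pfn j mu := by
  have key : ∀ nu : Ptn, ((MvPolynomial.aeval
      (![Polynomial.X, 1] : Fin 2 → Polynomial ℚ)) (Epoly m nu)).coeff (j + 1)
      = Qfn (j + 1) nu / (Nat.factorial (m + 2 - (j + 1)) : ℚ) := by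
    intro nu
    unfold Epoly
    simp only [map_sum, map_mul, map_pow, MvPolynomial.aeval_X, MvPolynomial.aeval_C]
    simp only [Matrix.cons_val_zero, Matrix.cons_val_one, one_pow, mul_one,
      Polynomial.finsetSum_coeff, ← Polynomial.C_eq_algebraMap, Polynomial.coeff_C_mul_X_pow]
    rw [Finset.sum_ite_eq, if_pos (by simp; omega)]
  have h1 := key lam
  rw [h, key mu] at h1
  have hf : ∀ n : ℕ, (Nat.factorial n : ℚ) ≠ 0 := fun n => by
    exact_mod_cast Nat.factorial_ne_zero n
  rw [div_left_inj' (hf _)] at h1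
  simp only [Qfn, Nat.add_eq_zero_iff, one_ne_zero, and_false, if_false,
    Nat.add_sub_cancel] at h1
  have h2 := add_right_cancel h1
  rw [div_left_inj' (hf _)] at h2
  exact h2.symm

lemma sum_eval (w n : ℕ) (a b : ℕ → ℚ)
    (h : ∀ j < n, ∑ i ∈ Finset.range w, a i ^ j = ∑ i ∈ Finset.range w, b i ^ j)
    (f : Polynomial ℚ) (hf : f.natDegree < n) :
    ∑ i ∈ Finset.range w, f.eval (a i) = ∑ i ∈ Finset.range w, f.eval (b i) := by
  simp only [Polynomial.eval_eq_sum_range' hf]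
  rw [Finset.sum_comm, Finset.sum_comm (s := Finset.range w)]
  refine Finset.sum_congr rfl fun j hj => ?_
  rw [← Finset.mul_sum, ← Finset.mul_sum, h j (Finset.mem_range.1 hj)]

lemma not_lt_aux (w : ℕ) (a b : ℕ → ℚ) (ha : ∀ i j, i < j → a j < a i)
    (hb : ∀ i j, i < j → b j < b i)
    (h : ∀ j < 2 * w + 1, ∑ i ∈ Finset.range w, a i ^ j = ∑ i ∈ Finset.range w, b i ^ j)
    (i : ℕ) (hi : i < w) (hlt : ∀ j < i, a j = b j) : ¬ b i < a i := by
  intro hba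
  let f : Polynomial ℚ :=
    (∏ j ∈ (Finset.range w).erase i, (Polynomial.X - Polynomial.C (a j))) *
      ∏ j ∈ Finset.range w, (Polynomial.X - Polynomial.C (b j))
  have hdeg : f.natDegree < 2 * w + 1 := by
    have h1 := Polynomial.natDegree_mul_le
      (p := ∏ j ∈ (Finset.range w).erase i, (Polynomial.X - Polynomial.C (a j)))
      (q := ∏ j ∈ Finset.range w, (Polynomial.X - Polynomial.C (b j)))
    rw [Polynomial.natDegree_finsetProd_X_sub_C_eq_card,
      Polynomial.natDegree_finsetProd_X_sub_C_eq_card] at h1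
    have h2 := Finset.card_le_card (Finset.erase_subset i (Finset.range w))
    simp only [Finset.card_range] at h1 h2
    show Polynomial.natDegree (_ * _) < _
    omega
  have hev : ∀ x, f.eval x = (∏ j ∈ (Finset.range w).erase i, (x - a j)) *
      ∏ j ∈ Finset.range w, (x - b j) := by
    intro x
    simp [f, Polynomial.eval_prod]
  have hs := sum_eval w _ a b h f hdeg
  have hB : ∑ k ∈ Finset.range w, f.eval (b k) = 0 := by
    refine Finset.sum_eq_zero fun k hk => ?_
    rw [hev, Finset.prod_eq_zero (s := Finset.range w) hk (sub_self _), mul_zero]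
  have hA : ∑ k ∈ Finset.range w, f.eval (a k) = f.eval (a i) := by
    refine Finset.sum_eq_single i (fun k hk hki => ?_) (fun hk => ?_)
    · rw [hev, Finset.prod_eq_zero (Finset.mem_erase.2 ⟨hki, hk⟩) (sub_self _), zero_mul]
    · exact absurd (Finset.mem_range.2 hi) hk
  rw [hA, hB, hev] at hs
  have hinj : ∀ k, k ≠ i → a i - a k ≠ 0 := by
    intro k hk
    rcases lt_or_gt_of_ne hk with hk | hk
    · have := ha _ _ hk
      linarith
    · have := ha _ _ hk
      intro h0
      linarith
  rcases mul_eq_zero.1 hs with h0 | h0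
  · obtain ⟨k, hk, hk0⟩ := Finset.prod_eq_zero_iff.1 h0
    exact hinj k (Finset.mem_erase.1 hk).1 hk0
  · obtain ⟨k, hk, hk0⟩ := Finset.prod_eq_zero_iff.1 h0
    rcases lt_trichotomy k i with hki | hki | hki
    · rw [← hlt k hki] at hk0
      exact hinj k hki.ne hk0
    · subst hki
      linarith
    · have := hb _ _ hki
      linarith

/-- Non-degeneracy of the dispersionless spectrum: for every weight `w` there is
an `m = m(w) ≥ 0` such that the polynomials `E_m^{[0]}(λ)` for partitions `λ` of
weight `w` are pairwise distinct. -/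
theorem statement2 (w : ℕ) :
    ∃ m : ℕ, ∀ lam mu : Ptn, lam.wt = w → mu.wt = w → lam ≠ mu →
      Epoly m lam ≠ Epoly m mu := by
  refine ⟨2 * w, fun lam mu hl hm hne hE => hne ?_⟩
  have hp : ∀ j < 2 * w + 1, ∑ i ∈ Finset.range w, lam.sh i ^ j
      = ∑ i ∈ Finset.range w, mu.sh i ^ j := by
    intro j hj
    have := Epoly_coeff _ lam mu hE j (by omega)
    rw [Pfn_eq lam w hl, Pfn_eq mu w hm] at this
    exact sub_left_injective this
  have hsh : ∀ i, i < w → lam.sh i = mu.sh i := by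
    intro i
    induction i using Nat.strong_induction_on with
    | _ i ih =>
      intro hi
      have h1 := not_lt_aux w lam.sh mu.sh (fun _ _ h => lam.sh_lt h) (fun _ _ h => mu.sh_lt h)
        hp i hi (fun j hj => ih j hj (hj.trans hi))
      have h2 := not_lt_aux w mu.sh lam.sh (fun _ _ h => mu.sh_lt h) (fun _ _ h => lam.sh_lt h)
        (fun j hj => (hp j hj).symm) i hi (fun j hj => (ih j hj (hj.trans hi)).symm)
      exact le_antisymm (not_lt.1 h1) (not_lt.1 h2)
  have hparts : lam.parts = mu.parts := by
    funext i
    rcases lt_or_ge i w with hi | hi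
    · have := hsh i hi
      unfold Ptn.sh at this
      have h3 : (lam.parts i : ℚ) = mu.parts i := by linarith
      exact_mod_cast h3
    · rw [lam.parts_zero w hl i hi, mu.parts_zero w hm i hi]
  cases lam
  cases mu
  simp only at hparts
  subst hparts
  rfl
end

section
/- Let k ≥ 1 and suppose λ ≠ μ are distinct partitions with |λ| = |μ| = k satisfying P_2(λ) = P_2(μ). Then Σ_{ν partition of k} |C_ν| χ_λ(C_ν) χ_μ(C_ν) (Σ_{i=1}^{ℓ(ν)} ν_i³) = 0. -/
open MvPolynomial

/-- The length `ℓ(λ)`: the number of nonzero parts. -/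
noncomputable def Ptn.len (lam : Ptn) : ℕ := Set.ncard {i : ℕ | lam.parts i ≠ 0}

/-- The generating series `Σ_{k≥1} T_k z^k / k` (with `T_k = X k`). -/
noncomputable def genT : PowerSeries (MvPolynomial ℕ+ ℚ) :=
  PowerSeries.mk fun m =>
    if h : m = 0 then 0 else ((m : ℚ)⁻¹) • (X (⟨m, Nat.pos_of_ne_zero h⟩ : ℕ+))

/-- The complete homogeneous polynomial `h_k(T)`, defined via
`Σ_{k≥0} h_k(T) z^k = exp(Σ_{k≥1} T_k z^k / k)`. -/
noncomputable def hsym (k : ℕ) : MvPolynomial ℕ+ ℚ :=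
  ∑ n ∈ Finset.range (k + 1),
    ((Nat.factorial n : ℚ)⁻¹) • (PowerSeries.coeff (R := MvPolynomial ℕ+ ℚ) k (genT ^ n))

/-- `h_k` for an integer index, with `h_k := 0` for `k < 0`. -/
noncomputable def hsymZ (z : ℤ) : MvPolynomial ℕ+ ℚ :=
  if 0 ≤ z then hsym z.toNat else 0

/-- The Schur polynomial `s_λ = det(h_{λ_i−i+j})_{1≤i,j≤ℓ(λ)}` (Jacobi–Trudi). -/
noncomputable def schur (lam : Ptn) : MvPolynomial ℕ+ ℚ :=
  (Matrix.of fun i j : Fin lam.len =>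
    hsymZ ((lam.parts i : ℤ) - ((i : ℕ) + 1) + ((j : ℕ) + 1))).det

/-- The monomial `T_ν = T_{ν_1} ⋯ T_{ν_{ℓ(ν)}}`. -/
noncomputable def Tmon (nu : Ptn) : MvPolynomial ℕ+ ℚ :=
  ∏ᶠ i : ℕ, if h : nu.parts i = 0 then 1
    else X (⟨nu.parts i, Nat.pos_of_ne_zero h⟩ : ℕ+)

/-- The multiplicity `m_i(ν)`: the number of parts of `ν` equal to `i`. -/
noncomputable def multPart (nu : Ptn) (i : ℕ) : ℕ := Set.ncard {j : ℕ | nu.parts j = i}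

/-- `z_ν = ∏_{i≥1} i^{m_i(ν)} m_i(ν)!`, so that `|C_ν| = k!/z_ν`. -/
noncomputable def zPart (nu : Ptn) : ℕ :=
  ∏ᶠ i : ℕ, i ^ multPart nu i * Nat.factorial (multPart nu i)

/-- The cardinality `|C_ν|` of the conjugacy class `C_ν ⊆ 𝔖_k` of permutations
whose disjoint cycle lengths (fixed points counted as 1-cycles) are the parts of
`ν`; in Mathlib terms, `σ ∈ C_ν` iff `σ.cycleType` is the multiset of parts of
`ν` that are `≥ 2`. -/
noncomputable def Ccard (k : ℕ) (nu : Ptn) : ℕ :=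
  Nat.card {σ : Equiv.Perm (Fin k) //
    σ.cycleType = ((Multiset.range nu.len).map nu.parts).filter (fun c => 2 ≤ c)}


theorem ptn_genT_const : PowerSeries.constantCoeff (R := MvPolynomial ℕ+ ℚ) genT = 0 := by
  rw [← PowerSeries.coeff_zero_eq_constantCoeff_apply]
  simp [genT, PowerSeries.coeff_mk]

theorem ptn_hsym_ext (k M : ℕ) (h : k < M) : hsym k = ∑ n ∈ Finset.range M,
    ((Nat.factorial n : ℚ)⁻¹) • (PowerSeries.coeff (R := MvPolynomial ℕ+ ℚ) k (genT ^ n)) := by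
  unfold hsym
  apply Finset.sum_subset
  · intro x; simp; omega
  · intro n _ hn
    simp at hn
    rw [PowerSeries.coeff_of_lt_order, smul_zero]
    refine lt_of_lt_of_le ?_ (PowerSeries.le_order_pow_of_constantCoeff_eq_zero n ptn_genT_const)
    exact_mod_cast (by omega : k < n)

theorem ptn_coeff_genT (k : ℕ) : PowerSeries.coeff (R := MvPolynomial ℕ+ ℚ) (k + 1) genT =
    (((k + 1 : ℕ) : ℚ)⁻¹) • (X k.succPNat : MvPolynomial ℕ+ ℚ) := by
  unfold genT
  rw [PowerSeries.coeff_mk]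
  exact dif_neg (Nat.succ_ne_zero k)

theorem ptn_dgenT (k : ℕ) : PowerSeries.coeff k (PowerSeries.derivative (MvPolynomial ℕ+ ℚ) genT)
    = X k.succPNat := by
  rw [PowerSeries.coeff_derivative, ptn_coeff_genT]
  rw [smul_mul_assoc, mul_comm, ← Nat.cast_succ, ← nsmul_eq_mul,
    ← Nat.cast_smul_eq_nsmul ℚ, smul_smul, inv_mul_cancel₀, one_smul]
  positivity

theorem ptn_newton (k : ℕ) : ((k + 1 : ℕ) : ℚ) • hsym (k + 1) =
    ∑ p ∈ Finset.HasAntidiagonal.antidiagonal k, X p.1.succPNat * hsym p.2 := by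
  have h1 : ((k + 1 : ℕ) : ℚ) • hsym (k + 1) = ∑ n ∈ Finset.range (k + 2),
      ((Nat.factorial n : ℚ)⁻¹) • (PowerSeries.coeff k
        (PowerSeries.derivative (MvPolynomial ℕ+ ℚ) (genT ^ n))) := by
    rw [hsym, Finset.smul_sum]
    refine Finset.sum_congr rfl fun n _ => ?_
    rw [PowerSeries.coeff_derivative, smul_comm, ← Nat.cast_succ, mul_comm, ← nsmul_eq_mul,
      ← Nat.cast_smul_eq_nsmul ℚ]
  rw [h1, Finset.sum_range_succ']
  have h2 : ∀ n : ℕ, ((Nat.factorial (n+1) : ℚ)⁻¹) • (PowerSeries.coeff k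
        (PowerSeries.derivative (MvPolynomial ℕ+ ℚ) (genT ^ (n+1)))) =
      ∑ p ∈ Finset.HasAntidiagonal.antidiagonal k, X p.1.succPNat *
        (((Nat.factorial n : ℚ)⁻¹) • (PowerSeries.coeff p.2 (genT ^ n))) := by
    intro n
    have : (PowerSeries.derivative (MvPolynomial ℕ+ ℚ) (genT ^ (n+1))) =
        ((n + 1 : ℕ) : ℚ) • (PowerSeries.derivative (MvPolynomial ℕ+ ℚ) genT * genT ^ n) := by
      rw [Derivation.leibniz_pow, Nat.cast_smul_eq_nsmul ℚ]
      simp [mul_comm]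
    rw [this]
    have h3 : ∀ (q : ℚ) (f : PowerSeries (MvPolynomial ℕ+ ℚ)),
        PowerSeries.coeff k (q • f) = q • PowerSeries.coeff k f := by
      intro q f; rfl
    rw [h3, smul_smul, Nat.factorial_succ, PowerSeries.coeff_mul, Finset.smul_sum]
    refine Finset.sum_congr rfl fun p _ => ?_
    rw [ptn_dgenT, mul_smul_comm]
    congr 1
    push_cast
    field_simp
  simp only [h2]
  rw [Finset.sum_comm]
  simp only [pow_zero, Derivation.map_one_eq_zero, map_zero, smul_zero, add_zero]
  refine Finset.sum_congr rfl fun p hp => ?_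
  rw [← Finset.mul_sum, ← ptn_hsym_ext]
  have := Finset.HasAntidiagonal.mem_antidiagonal.mp hp
  omega

theorem ptn_hsym_zero : hsym 0 = 1 := by
  simp [hsym]

theorem ptn_hsym_const (k : ℕ) (hk : k ≠ 0) : constantCoeff (hsym k) = 0 := by
  obtain ⟨k, rfl⟩ := Nat.exists_eq_succ_of_ne_zero hk
  have := congrArg (constantCoeff (R := ℚ)) (ptn_newton k)
  rw [map_sum] at this
  simp only [map_mul, constantCoeff_X, zero_mul, Finset.sum_const_zero, constantCoeff_smul] at this
  rcases smul_eq_zero.mp this with h | h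
  · exact absurd h (by positivity)
  · exact h

/-- `n ∂/∂T_n`. -/
noncomputable def ptnD (n : ℕ+) : Derivation ℚ (MvPolynomial ℕ+ ℚ) (MvPolynomial ℕ+ ℚ) :=
  ((n : ℕ) : ℚ) • pderiv n

theorem ptnD_X (n m : ℕ+) : ptnD n (X m) = if m = n then C ((n : ℕ) : ℚ) else 0 := by
  classical
  simp only [ptnD, Derivation.smul_apply, pderiv_X, Pi.single_apply]
  by_cases h : m = n
  · simp [h, smul_eq_C_mul]
  · simp [h]

theorem ptn_hZ_nat (k : ℕ) : hsymZ (k : ℤ) = hsym k := by simp [hsymZ]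
theorem ptn_hZ_neg (z : ℤ) (h : z < 0) : hsymZ z = 0 := by simp [hsymZ, h]

theorem ptn_newtonZ (k : ℕ) : ((k : ℕ) : ℚ) • hsym k =
    ∑ m ∈ Finset.range k, X (m.succPNat : ℕ+) * hsymZ ((k : ℤ) - (m + 1)) := by
  cases k with
  | zero => simp
  | succ k =>
    rw [ptn_newton, Finset.Nat.sum_antidiagonal_eq_sum_range_succ_mk]
    refine Finset.sum_congr rfl fun m hm => ?_
    have : m ≤ k := by simpa [Nat.lt_succ_iff] using hm
    rw [show (((k + 1 : ℕ) : ℤ) - (m + 1)) = ((k - m : ℕ) : ℤ) by omega, ptn_hZ_nat]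

theorem ptnD_h (n : ℕ+) (z : ℤ) : ptnD n (hsymZ z) = hsymZ (z - (n : ℕ)) := by
  rcases lt_or_ge z 0 with hz | hz
  · rw [ptn_hZ_neg z hz, ptn_hZ_neg _ (by omega), map_zero]
  lift z to ℕ using hz
  induction z using Nat.strong_induction_on with
  | _ k ih =>
  by_cases hk : k = 0
  · subst hk
    rw [ptn_hZ_nat, ptn_hsym_zero, Derivation.map_one_eq_zero, ptn_hZ_neg]
    have := n.pos
    push_cast; omega
  have hk' : (k : ℚ) ≠ 0 := by exact_mod_cast hk
  apply smul_right_injective _ hk'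
  simp only
  rw [ptn_hZ_nat, ← Derivation.map_smul, ptn_newtonZ, map_sum]
  have e1 : ∀ m ∈ Finset.range k, ptnD n (X (m.succPNat : ℕ+) * hsymZ ((k : ℤ) - (m + 1))) =
      X (m.succPNat : ℕ+) * hsymZ ((k : ℤ) - (n : ℕ) - (m + 1)) +
      (if m = n.natPred then C ((n : ℕ) : ℚ) * hsymZ (k - (n : ℕ)) else 0) := by
    intro m hm
    have hm' : m < k := by simpa using hm
    rw [Derivation.leibniz, ptnD_X]
    rw [show ((k : ℤ) - (m + 1)) = ((k - (m + 1) : ℕ) : ℤ) by omega, ih _ (by omega)]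
    rw [show (((k - (m + 1) : ℕ) : ℤ) - (n : ℕ)) = (k : ℤ) - (n : ℕ) - (m + 1) by omega]
    simp only [smul_eq_mul]
    congr 1
    have : m.succPNat = n ↔ m = n.natPred := by
      constructor
      · rintro rfl; simp
      · rintro rfl; simp
    simp only [this]
    split_ifs with h
    · rw [mul_comm]
      congr 2
      have := n.natPred_add_one
      omega
    · simp
  rw [Finset.sum_congr rfl e1, Finset.sum_add_distrib, Finset.sum_ite_eq']
  have hn := n.natPred_add_one
  by_cases hnk : (n : ℕ) ≤ k
  · rw [if_pos (by simp; omega)]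
    rw [show (k : ℤ) - (n : ℕ) = ((k - n : ℕ) : ℤ) by omega]
    rw [← Finset.sum_subset (s₁ := Finset.range (k - n)), ← ptn_newtonZ, ptn_hZ_nat, ← smul_eq_C_mul,
      ← add_smul]
    · congr 1
      rw [Nat.cast_sub hnk]; ring
    · intro x; simp; omega
    · intro x _ hx
      simp at hx
      rw [ptn_hZ_neg, mul_zero]
      omega
  · rw [if_neg (by simp; omega), add_zero, ptn_hZ_neg ((k : ℤ) - (n : ℕ)) (by omega), smul_zero]
    refine Finset.sum_eq_zero fun m _ => ?_
    rw [ptn_hZ_neg, mul_zero]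
    omega

/-- subtract `n` from coordinate `i`. -/
def ptnSh {ι : Type*} [DecidableEq ι] (c : ι → ℤ) (i : ι) (n : ℕ) : ι → ℤ :=
  fun l => c l - if l = i then (n : ℤ) else 0

theorem ptnD_prod {ι : Type*} [DecidableEq ι] (n : ℕ+) (c : ι → ℤ) (s : Finset ι) :
    ptnD n (∏ i ∈ s, hsymZ (c i)) = ∑ i ∈ s, ∏ l ∈ s, hsymZ (ptnSh c i n l) := by
  induction s using Finset.induction_on with
  | empty => simp
  | insert a s ha ih =>
    rw [Finset.prod_insert ha, Derivation.leibniz, ih, ptnD_h, Finset.sum_insert ha,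
      Finset.prod_insert ha, smul_eq_mul, smul_eq_mul, Finset.mul_sum, add_comm]
    congr 1
    · rw [mul_comm]
      congr 1
      · simp [ptnSh]
      · refine Finset.prod_congr rfl fun l hl => ?_
        have : l ≠ a := by rintro rfl; exact ha hl
        simp [ptnSh, this]
    · refine Finset.sum_congr rfl fun i hi => ?_
      have : a ≠ i := by rintro rfl; exact ha hi
      rw [Finset.prod_insert ha]
      simp [ptnSh, this]

/-- Jacobi–Trudi determinant in beta numbers. -/
noncomputable def ptnS (N : ℕ) (a : Fin N → ℤ) : MvPolynomial ℕ+ ℚ :=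
  (Matrix.of fun i j : Fin N => hsymZ (a i - (j : ℕ))).det

theorem ptnS_eq (N : ℕ) (a : Fin N → ℤ) : ptnS N a =
    ∑ σ : Equiv.Perm (Fin N), ((Equiv.Perm.sign σ : ℤ) : ℚ) • ∏ i, hsymZ (a i - (σ i : ℕ)) := by
  rw [ptnS, ← Matrix.det_transpose, Matrix.det_apply']
  refine Finset.sum_congr rfl fun σ _ => ?_
  rw [smul_eq_C_mul]
  simp

theorem ptnD_S (N : ℕ) (a : Fin N → ℤ) (n : ℕ+) :
    ptnD n (ptnS N a) = ∑ i, ptnS N (ptnSh a i n) := by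
  simp only [ptnS_eq]
  rw [map_sum, Finset.sum_comm]
  refine Finset.sum_congr rfl fun σ _ => ?_
  rw [Derivation.map_smul, ptnD_prod n (fun i => a i - (σ i : ℕ)), Finset.smul_sum]
  refine Finset.sum_congr rfl fun i _ => ?_
  congr 1
  refine Finset.prod_congr rfl fun l _ => ?_
  congr 1
  simp only [ptnSh]
  ring

theorem ptnS_neg (N : ℕ) (a : Fin N → ℤ) (i : Fin N) (h : a i < 0) : ptnS N a = 0 := by
  apply Matrix.det_eq_zero_of_row_eq_zero i
  intro j
  simp only [Matrix.of_apply]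
  exact ptn_hZ_neg _ (by omega)

/-- `z` of an exponent vector. -/
noncomputable def ptnZ (m : ℕ+ →₀ ℕ) : ℚ := m.prod fun i e => ((i : ℕ) : ℚ) ^ e * (e.factorial : ℚ)

theorem ptnZ_add (m : ℕ+ →₀ ℕ) (n : ℕ+) :
    ptnZ (m + Finsupp.single n 1) = (n : ℕ) * (m n + 1) * ptnZ m := by
  classical
  unfold ptnZ
  have h1 : (m + Finsupp.single n 1).support ⊆ insert n m.support := by
    intro x hx
    simp only [Finsupp.mem_support_iff, Finsupp.add_apply, Finset.mem_insert,
      Finsupp.single_apply] at hx ⊢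
    by_cases h : x = n
    · exact Or.inl h
    · right
      intro h2
      simp [h2, Ne.symm h] at hx
  rw [Finsupp.prod_of_support_subset _ h1 _ (by simp),
    Finsupp.prod_of_support_subset m (Finset.subset_insert n _) _ (by simp),
    ← Finset.mul_prod_erase _ _ (Finset.mem_insert_self n _),
    ← Finset.mul_prod_erase _ (fun i : ℕ+ => ((i : ℕ) : ℚ) ^ (m i) * ((m i).factorial : ℚ))
      (Finset.mem_insert_self n _), ← mul_assoc]
  congr 1
  · simp [Nat.factorial_succ, pow_succ]
    ring
  · refine Finset.prod_congr rfl fun i hi => ?_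
    have : i ≠ n := Finset.ne_of_mem_erase hi
    simp [Finsupp.single_apply, this.symm]

/-- Hall inner product. -/
noncomputable def ptnIp : MvPolynomial ℕ+ ℚ →ₗ[ℚ] MvPolynomial ℕ+ ℚ →ₗ[ℚ] ℚ :=
  (basisMonomials ℕ+ ℚ).constr ℚ fun m => ptnZ m • lcoeff ℚ m

theorem ptnIp_mon (m : ℕ+ →₀ ℕ) (g : MvPolynomial ℕ+ ℚ) :
    ptnIp (monomial m 1) g = ptnZ m * coeff m g := by
  have := (basisMonomials ℕ+ ℚ).constr_basis ℚ (fun m => ptnZ m • lcoeff ℚ m) m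
  rw [coe_basisMonomials] at this
  unfold ptnIp
  simp only at this
  rw [this]
  simp [lcoeff_apply]

theorem ptnIp_monC (m : ℕ+ →₀ ℕ) (r : ℚ) (g : MvPolynomial ℕ+ ℚ) :
    ptnIp (monomial m r) g = r * (ptnZ m * coeff m g) := by
  rw [← ptnIp_mon, show monomial m r = r • monomial m (1 : ℚ) by simp [smul_monomial]]
  simp

theorem ptnIp_adj (n : ℕ+) (f g : MvPolynomial ℕ+ ℚ) :
    ptnIp (ptnD n f) g = ptnIp f (X n * g) := by
  induction f using MvPolynomial.induction_on' with
  | add p q hp hq => simp only [map_add, LinearMap.add_apply, hp, hq]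
  | monomial m r =>
    rw [ptnIp_monC, coeff_X_mul']
    simp only [ptnD, Derivation.smul_apply, pderiv_monomial, map_smul, LinearMap.smul_apply]
    rw [ptnIp_monC]
    by_cases h : n ∈ m.support
    · rw [if_pos h]
      have hm : m - Finsupp.single n 1 + Finsupp.single n 1 = m := by
        apply tsub_add_cancel_of_le
        simp only [Finsupp.single_le_iff]
        simp at h; omega
      have := ptnZ_add (m - Finsupp.single n 1) n
      rw [hm] at this
      rw [this]
      have h2 : (((m - Finsupp.single n 1 : ℕ+ →₀ ℕ) n : ℕ) : ℚ) + 1 = m n := by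
        have := DFunLike.congr_fun hm n
        rw [Finsupp.add_apply, Finsupp.single_eq_same] at this
        exact_mod_cast this
      rw [h2, smul_eq_mul]
      ring
    · rw [if_neg h]
      simp at h
      simp [h]

theorem ptnIp_const (f : MvPolynomial ℕ+ ℚ) (r : ℚ) : ptnIp f (C r) = constantCoeff f * r := by
  classical
  induction f using MvPolynomial.induction_on' with
  | add p q hp hq => simp only [map_add, LinearMap.add_apply, hp, hq, add_mul]
  | monomial m q =>
    rw [ptnIp_monC, coeff_C, constantCoeff_monomial]
    by_cases h : m = 0
    · subst h; simp [ptnZ]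
    · rw [if_neg h, if_neg (Ne.symm h)]; simp

/-- coefficient extraction with integer exponents -/
noncomputable def ptnCf {N : ℕ} (c : Fin N → ℤ) (g : MvPolynomial (Fin N) ℚ) : ℚ :=
  if ∀ i, 0 ≤ c i then coeff (Finsupp.equivFunOnFinite.symm fun i => (c i).toNat) g else 0

theorem ptnCf_add {N : ℕ} (c : Fin N → ℤ) (f g : MvPolynomial (Fin N) ℚ) :
    ptnCf c (f + g) = ptnCf c f + ptnCf c g := by
  unfold ptnCf; split_ifs <;> simp

theorem ptnCf_sum {N : ℕ} {ι : Type*} (s : Finset ι) (c : Fin N → ℤ) (f : ι → MvPolynomial (Fin N) ℚ) :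
    ptnCf c (∑ i ∈ s, f i) = ∑ i ∈ s, ptnCf c (f i) := by
  unfold ptnCf; split_ifs <;> simp [coeff_sum]

theorem ptnCf_smul {N : ℕ} (c : Fin N → ℤ) (r : ℚ) (g : MvPolynomial (Fin N) ℚ) :
    ptnCf c (r • g) = r * ptnCf c g := by
  unfold ptnCf; split_ifs <;> simp

theorem ptnCf_mon {N : ℕ} (c : Fin N → ℤ) (s : Fin N →₀ ℕ) (g : MvPolynomial (Fin N) ℚ) :
    ptnCf c (monomial s 1 * g) = ptnCf (fun i => c i - (s i : ℕ)) g := by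
  unfold ptnCf
  rw [coeff_monomial_mul', one_mul]
  by_cases h : ∀ i, 0 ≤ c i - (s i : ℕ)
  · have h1 : ∀ i, 0 ≤ c i := fun i => by have := h i; omega
    rw [if_pos h1, if_pos h, if_pos]
    · congr 1
      ext i
      simp
    · intro i
      have := h i
      simp
      omega
  · rw [if_neg h]
    by_cases h1 : ∀ i, 0 ≤ c i
    · rw [if_pos h1, if_neg]
      intro h2
      apply h
      intro i
      have := h2 i
      have := h1 i
      have h3 : s i ≤ (c i).toNat := h2 i
      omega
    · rw [if_neg h1]

theorem ptnCf_C {N : ℕ} (c : Fin N → ℤ) (r : ℚ) :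
    ptnCf c (C r) = if ∀ i, c i = 0 then r else 0 := by
  classical
  unfold ptnCf
  rw [coeff_C]
  by_cases h : ∀ i, c i = 0
  · rw [if_pos h, if_pos (fun i => (h i).ge), if_pos]
    ext i; simp [h i]
  · rw [if_neg h]
    by_cases h1 : ∀ i, 0 ≤ c i
    · rw [if_pos h1, if_neg]
      intro h2
      apply h
      intro i
      have := DFunLike.congr_fun h2 i
      simp at this
      have := h1 i
      omega
    · rw [if_neg h1]

/-- power sum evaluation -/
noncomputable def ptnEv (N : ℕ) : MvPolynomial ℕ+ ℚ →ₐ[ℚ] MvPolynomial (Fin N) ℚ :=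
  aeval fun n : ℕ+ => ∑ i : Fin N, X i ^ (n : ℕ)

theorem ptn_hZ_const (z : ℤ) : constantCoeff (hsymZ z) = if z = 0 then 1 else 0 := by
  rcases lt_or_ge z 0 with hz | hz
  · rw [ptn_hZ_neg z hz, if_neg hz.ne, map_zero]
  lift z to ℕ using hz
  rw [ptn_hZ_nat]
  by_cases h : z = 0
  · subst h; simp [ptn_hsym_zero]
  · rw [ptn_hsym_const z h, if_neg (by exact_mod_cast h)]

theorem ptn_kernel {N : ℕ} (f : MvPolynomial ℕ+ ℚ) : ∀ (c : Fin N → ℤ),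
    ptnIp (∏ i, hsymZ (c i)) f = ptnCf c (ptnEv N f) := by
  induction f using MvPolynomial.induction_on with
  | C r =>
    intro c
    rw [ptnIp_const, map_prod]
    simp only [ptn_hZ_const]
    rw [show ptnEv N (C r) = C r from (ptnEv N).commutes r, ptnCf_C, Finset.prod_ite_zero]
    simp
  | add p q hp hq => intro c; simp only [map_add, hp, hq, ptnCf_add]
  | mul_X p n hp =>
    intro c
    rw [mul_comm, ← ptnIp_adj, ptnD_prod, map_sum, LinearMap.sum_apply, map_mul]
    rw [show ptnEv N (X n) = ∑ i : Fin N, X i ^ (n : ℕ) by simp [ptnEv], Finset.sum_mul, ptnCf_sum]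
    refine Finset.sum_congr rfl fun i _ => ?_
    rw [hp, X_pow_eq_monomial, ptnCf_mon]
    congr 1
    ext l
    simp only [ptnSh, Finsupp.single_apply, eq_comm (a := l)]
    split_ifs <;> simp

theorem ptn_kernelS {N : ℕ} (a : Fin N → ℤ) (f : MvPolynomial ℕ+ ℚ) :
    ptnIp (ptnS N a) f = ptnCf a ((Matrix.vandermonde (fun i : Fin N => (X i : MvPolynomial (Fin N) ℚ))).det
      * ptnEv N f) := by
  rw [ptnS_eq, map_sum, LinearMap.sum_apply, ← Matrix.det_transpose, Matrix.det_apply', Finset.sum_mul, ptnCf_sum]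
  refine Finset.sum_congr rfl fun σ _ => ?_
  rw [map_smul, LinearMap.smul_apply, ptn_kernel]
  have : (∏ i, (Matrix.vandermonde (fun i : Fin N => (X i : MvPolynomial (Fin N) ℚ))).transpose (σ i) i)
      = monomial (Finsupp.equivFunOnFinite.symm fun i => (σ i : ℕ)) 1 := by
    rw [monomial_eq, C_1, one_mul, Finsupp.prod_fintype _ _ (by simp)]
    simp [Matrix.vandermonde_apply]
  rw [this, mul_assoc, show (((Equiv.Perm.sign σ : ℤ) : MvPolynomial (Fin N) ℚ)) =
    C ((Equiv.Perm.sign σ : ℤ) : ℚ) by simp, ← smul_eq_C_mul, ptnCf_smul, ptnCf_mon]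
  simp

theorem ptn_deriv_prod {R ι : Type*} [CommRing R] [DecidableEq ι] (f g : ι → PowerSeries R)
    (h : ∀ i, PowerSeries.derivative R (f i) = g i * f i) (s : Finset ι) :
    PowerSeries.derivative R (∏ i ∈ s, f i) = (∑ i ∈ s, g i) * ∏ i ∈ s, f i := by
  induction s using Finset.induction_on with
  | empty => simp
  | insert a s ha ih =>
    rw [Finset.prod_insert ha, Derivation.leibniz, ih, h, Finset.sum_insert ha, smul_eq_mul, smul_eq_mul]
    ring

/-- geometric series -/
noncomputable def ptnF (N : ℕ) (l : Fin N) : PowerSeries (MvPolynomial (Fin N) ℚ) :=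
  PowerSeries.mk fun m => X l ^ m

theorem ptnF_deriv (N : ℕ) (l : Fin N) :
    PowerSeries.derivative _ (ptnF N l) = (PowerSeries.mk fun m => X l ^ (m + 1)) * ptnF N l := by
  ext1 m
  rw [PowerSeries.coeff_derivative, PowerSeries.coeff_mul]
  simp only [ptnF, PowerSeries.coeff_mk]
  rw [Finset.sum_congr rfl (g := fun _ => (X l : MvPolynomial (Fin N) ℚ) ^ (m + 1))]
  · simp [mul_comm]
  · intro p hp
    have := Finset.HasAntidiagonal.mem_antidiagonal.mp hp
    rw [← pow_add]
    congr 1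
    omega

theorem ptn_evh (N m : ℕ) : PowerSeries.coeff m (∏ l, ptnF N l) = ptnEv N (hsym m) := by
  induction m using Nat.strong_induction_on with
  | _ m ih =>
  cases m with
  | zero => simp [ptn_hsym_zero, ptnF, map_prod]
  | succ k =>
    have h1 := congrArg (PowerSeries.coeff k) (ptn_deriv_prod _ _ (ptnF_deriv N) Finset.univ)
    rw [PowerSeries.coeff_derivative, PowerSeries.coeff_mul] at h1
    have h2 := congrArg (ptnEv N) (ptn_newton k)
    rw [map_smul, map_sum] at h2
    have hk : ((k + 1 : ℕ) : ℚ) ≠ 0 := by positivity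
    apply smul_right_injective _ hk
    simp only
    rw [h2, Nat.cast_smul_eq_nsmul, nsmul_eq_mul, mul_comm, Nat.cast_succ, h1]
    refine Finset.sum_congr rfl fun p hp => ?_
    have := Finset.HasAntidiagonal.mem_antidiagonal.mp hp
    rw [ih _ (by omega), map_mul, map_sum]
    congr 1
    simp [ptnEv]

/-- `∏_{l' ≠ l} (1 - x_{l'} t)` -/
noncomputable def ptnQ (N : ℕ) (l : Fin N) : Polynomial (MvPolynomial (Fin N) ℚ) :=
  ∏ i ∈ Finset.univ.erase l, (1 - Polynomial.C (X i) * Polynomial.X)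

theorem ptnQ_deg (N : ℕ) (l : Fin N) : (ptnQ N l).natDegree < N := by
  have h1 : (ptnQ N l).natDegree ≤ ∑ i ∈ Finset.univ.erase l, 1 := by
    refine (Polynomial.natDegree_prod_le _ _).trans (Finset.sum_le_sum fun i _ => ?_)
    compute_degree
  have h2 := l.pos
  simp [Finset.card_erase_of_mem] at h1
  omega

theorem ptnF_inv (N : ℕ) (l : Fin N) :
    (1 - PowerSeries.C (X l) * PowerSeries.X) * ptnF N l = 1 := by
  ext1 m
  rw [sub_mul, one_mul, map_sub, mul_assoc, PowerSeries.coeff_C_mul]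
  cases m with
  | zero => simp [ptnF]
  | succ m =>
    rw [PowerSeries.coeff_succ_X_mul]
    simp [ptnF, PowerSeries.coeff_one, pow_succ']

theorem ptnQ_mul (N : ℕ) (l : Fin N) :
    ((ptnQ N l : Polynomial _) : PowerSeries (MvPolynomial (Fin N) ℚ)) * ∏ i, ptnF N i = ptnF N l := by
  rw [← Finset.mul_prod_erase _ _ (Finset.mem_univ l), mul_left_comm]
  have : ((ptnQ N l : Polynomial _) : PowerSeries (MvPolynomial (Fin N) ℚ)) =
      ∏ i ∈ Finset.univ.erase l, (1 - PowerSeries.C (X i) * PowerSeries.X) := by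
    unfold ptnQ
    rw [← Polynomial.coeToPowerSeries.ringHom_apply, map_prod]
    simp
  rw [this, ← Finset.prod_mul_distrib]
  simp [ptnF_inv]

theorem ptnQ_coeff (N : ℕ) (l : Fin N) (m : ℕ) :
    ∑ j : Fin N, ptnEv N (hsymZ ((m : ℤ) - (j : ℕ))) * (ptnQ N l).coeff j = X l ^ m := by
  have h := congrArg (PowerSeries.coeff m) (ptnQ_mul N l)
  rw [PowerSeries.coeff_mul, Finset.Nat.sum_antidiagonal_eq_sum_range_succ_mk] at h
  simp only [ptnF, PowerSeries.coeff_mk] at h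
  rw [← h, Fin.sum_univ_eq_sum_range
    (fun j => ptnEv N (hsymZ ((m : ℤ) - (j : ℕ))) * (ptnQ N l).coeff j) N]
  have e1 : ∀ j ∈ Finset.range (m + 1), (PowerSeries.coeff j)
      ((ptnQ N l : Polynomial _) : PowerSeries (MvPolynomial (Fin N) ℚ)) *
      PowerSeries.coeff (m - j) (∏ i, ptnF N i) =
      ptnEv N (hsymZ ((m : ℤ) - (j : ℕ))) * (ptnQ N l).coeff j := by
    intro j hj
    simp at hj
    rw [ptn_evh, Polynomial.coeff_coe, mul_comm, ← ptn_hZ_nat, Nat.cast_sub (by omega)]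
  refine Eq.trans ?_ (Finset.sum_congr rfl e1).symm
  rw [Finset.sum_subset (Finset.range_subset_range.mpr (le_max_left N (m + 1))),
    ← Finset.sum_subset (Finset.range_subset_range.mpr (le_max_right N (m + 1)))]
  · intro j _ hj
    simp at hj
    rw [ptn_hZ_neg _ (by omega)]; simp
  · intro j _ hj
    simp at hj
    rw [Polynomial.coeff_eq_zero_of_natDegree_lt, mul_zero]
    have := ptnQ_deg N l
    omega

theorem ptnS_id (N : ℕ) : ptnS N (fun i => ((i : ℕ) : ℤ)) = 1 := by
  unfold ptnS
  rw [Matrix.det_of_isLowerTriangular]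
  · simp [hsymZ, ptn_hsym_zero]
  · intro i j hij
    have hij' : i < j := hij
    simp only [Matrix.of_apply]
    apply ptn_hZ_neg
    have : (i : ℕ) < j := hij'
    omega

theorem ptn_bialt_aux (N : ℕ) (b : Fin N → ℕ) :
    ptnEv N (ptnS N (fun i => (b i : ℤ))) * (Matrix.of fun j l : Fin N => (ptnQ N l).coeff j).det =
      (Matrix.of fun i l : Fin N => (X l : MvPolynomial (Fin N) ℚ) ^ b i).det := by
  rw [ptnS, AlgHom.map_det, ← Matrix.det_mul]
  congr 1
  ext1 i l
  rw [Matrix.mul_apply]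
  exact ptnQ_coeff N l (b i)

theorem ptn_bialt (N : ℕ) (b : Fin N → ℕ) :
    (Matrix.vandermonde (fun i : Fin N => (X i : MvPolynomial (Fin N) ℚ))).det *
      ptnEv N (ptnS N (fun i => (b i : ℤ))) =
      (Matrix.of fun i l : Fin N => (X l : MvPolynomial (Fin N) ℚ) ^ b i).det := by
  rw [← ptn_bialt_aux, mul_comm]
  congr 1
  have := ptn_bialt_aux N (fun i => (i : ℕ))
  rw [ptnS_id, map_one, one_mul] at this
  rw [this, ← Matrix.det_transpose]
  rfl

theorem ptn_orth (N : ℕ) (a b : Fin N → ℤ) (h : ptnIp (ptnS N a) (ptnS N b) ≠ 0) :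
    ∃ τ : Equiv.Perm (Fin N), ∀ i, a i = b (τ i) := by
  have hb : ∀ i, 0 ≤ b i := by
    intro i
    by_contra hi
    rw [ptnS_neg N b i (by omega)] at h
    simp at h
  lift b to Fin N → ℕ using hb
  rw [ptn_kernelS, ptn_bialt, Matrix.det_apply', ptnCf_sum] at h
  obtain ⟨τ, _, hτ⟩ := Finset.exists_ne_zero_of_sum_ne_zero h
  refine ⟨τ, ?_⟩
  have : (∏ i, (Matrix.of fun i l : Fin N => (X l : MvPolynomial (Fin N) ℚ) ^ b i) (τ i) i)
      = monomial (Finsupp.equivFunOnFinite.symm fun i => b (τ i)) 1 * C 1 := by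
    rw [monomial_eq, C_1, one_mul, Finsupp.prod_fintype _ _ (by simp)]
    simp
  rw [this, show (((Equiv.Perm.sign τ : ℤ) : MvPolynomial (Fin N) ℚ)) =
    C ((Equiv.Perm.sign τ : ℤ) : ℚ) by simp, ← smul_eq_C_mul, ptnCf_smul, ptnCf_mon, ptnCf_C] at hτ
  split_ifs at hτ with h1
  · intro i
    have := h1 i
    simp at this
    simp; omega
  · simp at hτ

theorem ptn_key (N : ℕ) (a b : Fin N → ℤ) (hsq : ∑ i, (a i) ^ 2 = ∑ i, (b i) ^ 2)
    (hne : Set.range a ≠ Set.range b) (n : ℕ+) :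
    ptnIp (ptnD n (ptnS N a)) (ptnD n (ptnS N b)) = 0 := by
  rw [ptnD_S, ptnD_S, map_sum]
  refine Finset.sum_eq_zero fun j _ => ?_
  rw [map_sum, LinearMap.sum_apply]
  refine Finset.sum_eq_zero fun i _ => ?_
  by_contra h
  obtain ⟨τ, hτ⟩ := ptn_orth _ _ _ h
  have hs : ∀ (c : Fin N → ℤ) (i : Fin N) (φ : ℤ → ℤ),
      ∑ l, φ (ptnSh c i n l) = ∑ l, φ (c l) - φ (c i) + φ (c i - n) := by
    intro c i φ
    rw [← Finset.add_sum_erase _ _ (Finset.mem_univ i), ← Finset.add_sum_erase _ (fun l => φ (c l)) (Finset.mem_univ i)]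
    have : ∑ l ∈ Finset.univ.erase i, φ (ptnSh c i n l) = ∑ l ∈ Finset.univ.erase i, φ (c l) := by
      refine Finset.sum_congr rfl fun l hl => ?_
      have : l ≠ i := Finset.ne_of_mem_erase hl
      simp [ptnSh, this]
    rw [this]
    simp [ptnSh]
    ring
  have he : ∀ φ : ℤ → ℤ, ∑ l, φ (a l) - φ (a i) + φ (a i - n) = ∑ l, φ (b l) - φ (b j) + φ (b j - n) := by
    intro φ
    rw [← hs, ← hs, ← Equiv.sum_comp τ (fun l => φ (ptnSh b j n l))]
    simp only [hτ]
  have hab : a i = b j := by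
    have := he (fun x => x ^ 2)
    simp only [hsq] at this
    have hn : (n : ℤ) ≠ 0 := by have := n.pos; positivity
    have : (2 * (n : ℤ)) * (a i - b j) = 0 := by linarith
    rcases mul_eq_zero.mp this with h | h
    · omega
    · omega
  have he' : ∀ φ : ℤ → ℤ, ∑ l, φ (a l) = ∑ l, φ (b l) := by
    intro φ
    have := he φ
    rw [hab] at this
    linarith
  apply hne
  have hr : ∀ (c : Fin N → ℤ) (v : ℤ), v ∈ Set.range c ↔ ∑ l, (if c l = v then 1 else 0 : ℤ) ≠ 0 := by
    intro c v
    rw [Finset.sum_boole]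
    simp [Finset.filter_eq_empty_iff]
  ext v
  rw [hr, hr, he' (fun x => if x = v then 1 else 0)]

theorem ptn_lt_len (lam : Ptn) (i : ℕ) : i < lam.len ↔ lam.parts i ≠ 0 := by
  classical
  have hex : ∃ N, lam.parts N = 0 := by
    obtain ⟨N, hN⟩ := lam.eventually_zero
    exact ⟨N, hN N le_rfl⟩
  have hset : {i : ℕ | lam.parts i ≠ 0} = ((Finset.range (Nat.find hex) : Finset ℕ) : Set ℕ) := by
    ext j
    simp only [Set.mem_ofPred_eq, Finset.coe_range, Set.mem_Iio]
    constructor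
    · intro h
      by_contra h2
      have := lam.antitone (not_lt.mp h2)
      rw [Nat.find_spec hex] at this
      omega
    · intro h
      exact Nat.find_min hex h
  have hl : lam.len = Nat.find hex := by
    unfold Ptn.len
    rw [hset, Set.ncard_coe_finset, Finset.card_range]
  have := Set.ext_iff.mp hset i
  rw [hl]
  simpa using this.symm

theorem ptn_parts_zero (lam : Ptn) (i : ℕ) (h : lam.len ≤ i) : lam.parts i = 0 := by
  by_contra h2
  have := (ptn_lt_len lam i).mpr h2
  omega

theorem ptn_finsum {M : Type*} [AddCommMonoid M] (lam : Ptn) (f : ℕ → M) (N : ℕ) (hN : lam.len ≤ N)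
    (hf : ∀ i, lam.parts i = 0 → f i = 0) : ∑ᶠ i, f i = ∑ i ∈ Finset.range N, f i := by
  apply finsum_eq_sum_of_support_subset
  intro i hi
  simp only [Finset.coe_range, Set.mem_Iio]
  by_contra h
  exact hi (hf i (ptn_parts_zero lam i (by omega)))

theorem ptn_wt (lam : Ptn) (N : ℕ) (hN : lam.len ≤ N) : lam.wt = ∑ i ∈ Finset.range N, lam.parts i :=
  ptn_finsum lam _ N hN fun _ h => h

theorem ptn_parts_le (lam : Ptn) (i : ℕ) : lam.parts i ≤ lam.wt := by
  by_cases h : i < lam.len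
  · rw [ptn_wt lam _ le_rfl]
    exact Finset.single_le_sum (f := lam.parts) (fun _ _ => Nat.zero_le _) (Finset.mem_range.mpr h)
  · rw [ptn_parts_zero lam i (by omega)]; omega

theorem ptn_len_le (lam : Ptn) : lam.len ≤ lam.wt := by
  rw [ptn_wt lam _ le_rfl]
  calc lam.len = ∑ i ∈ Finset.range lam.len, 1 := by simp
    _ ≤ _ := Finset.sum_le_sum fun i hi => by
      have := (ptn_lt_len lam i).mp (by simpa using hi)
      omega

theorem ptn_ext (lam mu : Ptn) (h : lam.parts = mu.parts) : lam = mu := by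
  cases lam; cases mu; simp at h; subst h; rfl

theorem ptn_finite (k : ℕ) : {nu : Ptn | nu.wt = k}.Finite := by
  let φ : Ptn → (Fin k → Fin (k + 1)) := fun nu i => Fin.ofNat (k + 1) (nu.parts i)
  apply Set.Finite.of_finite_image (f := φ) (Set.toFinite _)
  intro a ha b hb hab
  simp only [Set.mem_ofPred_eq] at ha hb
  apply ptn_ext
  funext i
  by_cases hi : i < k
  · have := congrArg Fin.val (congrFun hab ⟨i, hi⟩)
    have h1 := ptn_parts_le a i
    have h2 := ptn_parts_le b i
    simp only [φ, Fin.val_ofNat] at this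
    rw [Nat.mod_eq_of_lt (by omega), Nat.mod_eq_of_lt (by omega)] at this
    exact this
  · have h1 := ptn_len_le a
    have h2 := ptn_len_le b
    rw [ptn_parts_zero a i (by omega), ptn_parts_zero b i (by omega)]

/-- beta numbers -/
def ptnBeta (lam : Ptn) (N : ℕ) : Fin N → ℤ := fun i => (lam.parts (N - 1 - i) : ℤ) + (i : ℕ)

theorem ptn_schur_len (lam : Ptn) : schur lam = ptnS lam.len (ptnBeta lam lam.len) := by
  unfold schur ptnS
  rw [← Matrix.det_submatrix_equiv_self Fin.revPerm]
  congr 1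
  ext1 i j
  simp only [Matrix.submatrix_apply, Matrix.of_apply, Fin.revPerm_apply, Fin.val_rev, ptnBeta]
  have hi := i.2
  have hj := j.2
  rw [show lam.len - (↑i + 1) = lam.len - 1 - ↑i by omega]
  congr 1
  omega

theorem ptn_S_succ (lam : Ptn) (N : ℕ) (h : lam.len ≤ N) :
    ptnS (N + 1) (ptnBeta lam (N + 1)) = ptnS N (ptnBeta lam N) := by
  unfold ptnS
  rw [Matrix.det_succ_row_zero, Finset.sum_eq_single 0]
  · have : hsymZ (ptnBeta lam (N + 1) 0 - ((0 : Fin (N + 1)) : ℕ)) = 1 := by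
      simp [ptnBeta, ptn_parts_zero lam N h, hsymZ, ptn_hsym_zero]
    simp only [Matrix.of_apply, this]
    simp only [Fin.val_zero, pow_zero, one_mul]
    congr 1
    ext1 i j
    simp only [Matrix.submatrix_apply, Matrix.of_apply, ptnBeta, Fin.succAbove_zero, Fin.val_succ]
    rw [show N + 1 - 1 - (↑i + 1) = N - 1 - ↑i by omega]
    congr 1
    push_cast
    ring
  · intro j _ hj
    simp only [Matrix.of_apply]
    rw [ptn_hZ_neg]
    · simp
    · have : (j : ℕ) ≠ 0 := fun h => hj (Fin.ext h)
      have h0 : ptnBeta lam (N + 1) 0 = 0 := by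
        simp [ptnBeta, ptn_parts_zero lam N h]
      rw [h0]
      omega
  · simp

theorem ptn_schur (lam : Ptn) (N : ℕ) (h : lam.len ≤ N) : schur lam = ptnS N (ptnBeta lam N) := by
  induction N, h using Nat.le_induction with
  | base => exact ptn_schur_len lam
  | succ n hn ih => rw [ih, ptn_S_succ lam n hn]

theorem ptn_sq (lam : Ptn) (N : ℕ) (h : lam.len ≤ N) : ((∑ i, (ptnBeta lam N i) ^ 2 : ℤ) : ℚ) =
    Pfn 2 lam + (2 * N - 1) * lam.wt + ∑ i ∈ Finset.range N, ((N : ℚ) - 1 - i) ^ 2 := by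
  rw [show (∑ i, (ptnBeta lam N i) ^ 2 : ℤ) =
    ∑ i ∈ Finset.range N, ((lam.parts (N - 1 - i) : ℤ) + (i : ℕ)) ^ 2 from
    Fin.sum_univ_eq_sum_range (fun i => ((lam.parts (N - 1 - i) : ℤ) + (i : ℕ)) ^ 2) N]
  rw [← Finset.sum_range_reflect, Pfn, ptn_finsum lam _ N h, ptn_wt lam N h]
  · push_cast
    rw [Finset.mul_sum, ← Finset.sum_add_distrib, ← Finset.sum_add_distrib]
    refine Finset.sum_congr rfl fun i hi => ?_
    have hi : i < N := by simpa using hi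
    rw [show N - 1 - (N - 1 - i) = i by omega]
    rw [Nat.cast_sub (by omega), Nat.cast_sub (by omega)]
    push_cast
    ring
  · intro i hi
    rw [hi]; simp

theorem ptn_beta_mono (lam : Ptn) (N : ℕ) : StrictMono (ptnBeta lam N) := by
  intro i j hij
  unfold ptnBeta
  have h1 : (i : ℕ) < j := hij
  have := lam.antitone (show N - 1 - (j : ℕ) ≤ N - 1 - i by omega)
  omega

theorem ptn_beta_range (lam mu : Ptn) (N : ℕ) (h1 : lam.len ≤ N) (h2 : mu.len ≤ N)
    (h : Set.range (ptnBeta lam N) = Set.range (ptnBeta mu N)) : lam = mu := by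
  have h3 := (StrictMono.range_inj (ptn_beta_mono lam N) (ptn_beta_mono mu N)).mp h
  apply ptn_ext
  funext i
  by_cases hi : i < N
  · have := congrFun h3 ⟨N - 1 - i, by omega⟩
    simp only [ptnBeta] at this
    rw [show N - 1 - (N - 1 - i) = i by omega] at this
    omega
  · rw [ptn_parts_zero lam i (by omega), ptn_parts_zero mu i (by omega)]

/-- The main vanishing. -/
theorem ptn_main (lam mu : Ptn) (hw : lam.wt = mu.wt) (hne : lam ≠ mu)
    (hP : Pfn 2 lam = Pfn 2 mu) (n : ℕ+) :
    ptnIp (ptnD n (schur lam)) (ptnD n (schur mu)) = 0 := by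
  have h1 : lam.len ≤ lam.wt := ptn_len_le lam
  have h2 : mu.len ≤ lam.wt := by rw [hw]; exact ptn_len_le mu
  rw [ptn_schur lam _ h1, ptn_schur mu _ h2]
  apply ptn_key
  · have e1 := ptn_sq lam _ h1
    have e2 := ptn_sq mu _ h2
    rw [hP, hw] at e1
    rw [hw] at e2
    rw [hw]
    exact_mod_cast e1.trans e2.symm
  · intro h
    exact hne (ptn_beta_range lam mu _ h1 h2 h)

/-- multiset of parts -/
noncomputable def ptnM (nu : Ptn) : Multiset ℕ := (Multiset.range nu.len).map nu.parts

theorem ptnM_pos (nu : Ptn) (x : ℕ) (hx : x ∈ ptnM nu) : 1 ≤ x := by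
  simp only [ptnM, Multiset.mem_map, Multiset.mem_range] at hx
  obtain ⟨i, hi, rfl⟩ := hx
  have := (ptn_lt_len nu i).mp hi
  omega

theorem ptnM_inj (nu nu' : Ptn) (h : ptnM nu = ptnM nu') : nu = nu' := by
  have hl : nu.len = nu'.len := by
    have := congrArg Multiset.card h
    simpa [ptnM] using this
  have hp : List.Perm ((List.range nu.len).map nu.parts) ((List.range nu'.len).map nu'.parts) := by
    rw [← Multiset.coe_eq_coe]
    exact h
  have hs : ∀ a : Ptn, List.Pairwise (· ≥ ·) ((List.range a.len).map a.parts) := by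
    intro a
    rw [List.pairwise_map]
    exact List.pairwise_lt_range.imp fun hij => a.antitone hij.le
  have he := hp.eq_of_pairwise (fun a b _ _ h1 h2 => le_antisymm h2 h1) (hs nu) (hs nu')
  apply ptn_ext
  funext i
  by_cases hi : i < nu.len
  · have := congrArg (fun l => l[i]?) he
    simpa [hi, ← hl] using this
  · rw [ptn_parts_zero nu i (by omega), ptn_parts_zero nu' i (by omega)]

theorem ptnM_sum (nu : Ptn) : (ptnM nu).sum = nu.wt := by
  rw [ptn_wt nu _ le_rfl]; rfl

theorem ptnM_count (nu : Ptn) (n : ℕ) (hn : 1 ≤ n) : (ptnM nu).count n = multPart nu n := by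
  have : {j : ℕ | nu.parts j = n} = ((Finset.filter (fun j => n = nu.parts j) (Finset.range nu.len) : Finset ℕ) : Set ℕ) := by
    ext j
    simp only [Set.mem_ofPred_eq, Finset.coe_filter, Finset.mem_range, ptn_lt_len]
    omega
  rw [multPart, this, Set.ncard_coe_finset, ptnM, Multiset.count_map]
  rfl

theorem ptn_mult_zero (nu : Ptn) : multPart nu 0 = 0 := by
  apply Set.Infinite.ncard
  apply Set.infinite_of_forall_exists_gt
  intro a
  exact ⟨max (a + 1) nu.len, ptn_parts_zero _ _ (le_max_right _ _), by omega⟩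

theorem ptn_zPart (nu : Ptn) (s : Finset ℕ) (h : ∀ i, 1 ≤ i → (ptnM nu).count i ≠ 0 → i ∈ s) :
    zPart nu = ∏ i ∈ s, i ^ multPart nu i * Nat.factorial (multPart nu i) := by
  apply finprod_eq_prod_of_mulSupport_subset
  intro i hi
  rw [Function.mem_mulSupport] at hi
  by_cases h0 : i = 0
  · subst h0
    rw [ptn_mult_zero] at hi
    simp at hi
  · apply h i (by omega)
    intro hc
    rw [ptnM_count nu i (by omega)] at hc
    rw [hc] at hi
    simp at hi

theorem ptn_Ccard (nu : Ptn) (k : ℕ) (hk : nu.wt = k) : Ccard k nu * zPart nu = k.factorial := by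
  classical
  set m := (ptnM nu).filter (fun c => 2 ≤ c) with hm
  have hsplit : m + Multiset.replicate ((ptnM nu).count 1) 1 = ptnM nu := by
    rw [← Multiset.filter_add_not (fun c => 2 ≤ c) (ptnM nu)]
    congr 1
    rw [← Multiset.filter_eq', Multiset.filter_add_not]
    apply Multiset.filter_congr
    intro x hx
    have := ptnM_pos nu x hx
    omega
  have hsum : m.sum + (ptnM nu).count 1 = k := by
    have := congrArg Multiset.sum hsplit
    rw [Multiset.sum_add, ptnM_sum, hk] at this
    simpa using this
  have h := Equiv.Perm.card_of_cycleType_mul_eq (Fin k) m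
  rw [if_pos] at h
  swap
  · refine ⟨by simp; omega, fun a ha => ?_⟩
    rw [hm] at ha
    exact (Multiset.mem_filter.mp ha).2
  rw [Fintype.card_fin] at h
  rw [← h]
  congr 1
  · unfold Ccard
    rw [Nat.card_eq_fintype_card, Fintype.card_subtype]
    rfl
  · have h1 : 1 ∉ m.toFinset := by simp [hm]
    rw [ptn_zPart nu (insert 1 m.toFinset), Finset.prod_insert h1, one_pow, one_mul, mul_assoc,
      Finset.prod_multiset_count, ← Finset.prod_mul_distrib]
    · congr 1
      · rw [← ptnM_count nu 1 le_rfl]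
        congr 1
        omega
      · refine Finset.prod_congr rfl fun n hn => ?_
        have h2 : 2 ≤ n := by
          rw [Multiset.mem_toFinset, hm] at hn
          exact (Multiset.mem_filter.mp hn).2
        rw [hm, Multiset.count_filter_of_pos h2, ptnM_count nu n (by omega)]
    · intro i hi hc
      rw [Finset.mem_insert, Multiset.mem_toFinset, hm, Multiset.mem_filter]
      by_cases h2 : 2 ≤ i
      · exact Or.inr ⟨Multiset.count_ne_zero.mp hc, h2⟩
      · left; omega

/-- exponent vector -/
noncomputable def ptnE (nu : Ptn) : ℕ+ →₀ ℕ :=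
  ∑ i ∈ Finset.range nu.len, Finsupp.single (nu.parts i).toPNat' 1

theorem ptnE_apply (nu : Ptn) (n : ℕ+) :
    ptnE nu n = ∑ i ∈ Finset.range nu.len, if nu.parts i = n then 1 else 0 := by
  unfold ptnE
  rw [Finsupp.finsetSum_apply]
  refine Finset.sum_congr rfl fun i hi => ?_
  have := (ptn_lt_len nu i).mp (by simpa using hi)
  rw [Finsupp.single_apply]
  congr 1
  rw [← PNat.coe_inj, Nat.toPNat'_coe, if_pos (by omega)]

theorem ptnE_count (nu : Ptn) (n : ℕ+) : ptnE nu n = (ptnM nu).count (n : ℕ) := by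
  rw [ptnE_apply, ptnM, Multiset.count_map, Finset.sum_boole]
  simp only [eq_comm (a := (n : ℕ))]
  rfl

theorem ptnE_inj (nu nu' : Ptn) (h : ptnE nu = ptnE nu') : nu = nu' := by
  apply ptnM_inj
  ext n
  by_cases hn : n = 0
  · subst hn
    rw [Multiset.count_eq_zero_of_notMem, Multiset.count_eq_zero_of_notMem]
    · intro h; have := ptnM_pos _ _ h; omega
    · intro h; have := ptnM_pos _ _ h; omega
  · have := DFunLike.congr_fun h (n.toPNat (Nat.pos_of_ne_zero hn))
    rw [ptnE_count, ptnE_count] at this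
    exact this

theorem ptn_Tmon (nu : Ptn) : Tmon nu = monomial (ptnE nu) 1 := by
  have : Tmon nu = ∏ i ∈ Finset.range nu.len, (X (nu.parts i).toPNat' : MvPolynomial ℕ+ ℚ) := by
    unfold Tmon
    rw [finprod_eq_prod_of_mulSupport_subset (s := Finset.range nu.len)]
    · refine Finset.prod_congr rfl fun i hi => ?_
      have := (ptn_lt_len nu i).mp (by simpa using hi)
      rw [dif_neg this]
      congr 1
      apply PNat.eq
      rw [Nat.toPNat'_coe, if_pos (by omega)]
      rfl
    · intro i hi
      rw [Function.mem_mulSupport] at hi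
      simp only [Finset.coe_range, Set.mem_Iio, ptn_lt_len]
      intro h
      rw [dif_pos h] at hi
      exact hi rfl
  rw [this, ptnE, monomial_sum_one]
  rfl

theorem ptnE_z (nu : Ptn) : ptnZ (ptnE nu) = zPart nu := by
  classical
  rw [ptn_zPart nu ((ptnE nu).support.image (fun n : ℕ+ => (n : ℕ)))]
  · rw [Finset.prod_image (by intro a _ b _ h; exact PNat.eq h), ptnZ, Finsupp.prod]
    push_cast
    refine Finset.prod_congr rfl fun n _ => ?_
    rw [ptnE_count, ptnM_count nu n n.pos]
  · intro i hi hc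
    rw [Finset.mem_image]
    refine ⟨i.toPNat hi, ?_, rfl⟩
    rw [Finsupp.mem_support_iff, ptnE_count]
    exact hc

theorem ptn_cube (nu : Ptn) (k : ℕ) (hk : nu.wt = k) : ∑ᶠ i : ℕ, ((nu.parts i : ℚ)) ^ 3 =
    ∑ n ∈ Finset.range k, ((n : ℚ) + 1) ^ 3 * (ptnE nu n.succPNat : ℚ) := by
  rw [ptn_finsum nu _ nu.len le_rfl (by intro i hi; simp [hi])]
  simp only [ptnE_apply]
  push_cast
  simp only [Finset.mul_sum]
  rw [Finset.sum_comm]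
  refine Finset.sum_congr rfl fun i hi => ?_
  have h1 := (ptn_lt_len nu i).mp (by simpa using hi)
  have h2 := ptn_parts_le nu i
  rw [Finset.sum_eq_single (nu.parts i - 1)]
  · rw [if_pos (by simp; omega), mul_one, Nat.cast_sub (by omega)]
    simp
  · intro b _ hb
    rw [if_neg (by simp; omega), mul_zero]
  · intro h
    simp at h
    omega

theorem ptn_coeff_XD (n : ℕ+) (f : MvPolynomial ℕ+ ℚ) (m : ℕ+ →₀ ℕ) :
    coeff m (X n * ptnD n f) = (n : ℕ) * m n * coeff m f := by
  rw [coeff_X_mul']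
  split_ifs with h
  · have hm : m - Finsupp.single n 1 + Finsupp.single n 1 = m := by
      apply tsub_add_cancel_of_le
      simp only [Finsupp.single_le_iff]
      simp at h; omega
    have h2 : (((m - Finsupp.single n 1 : ℕ+ →₀ ℕ) n : ℕ) : ℚ) + 1 = m n := by
      have := DFunLike.congr_fun hm n
      rw [Finsupp.add_apply, Finsupp.single_eq_same] at this
      exact_mod_cast this
    simp only [ptnD, Derivation.smul_apply, coeff_smul, coeff_pderiv, hm, h2, smul_eq_mul]
    ring
  · simp at h
    simp [h]

theorem ptn_z_ne (nu : Ptn) : (zPart nu : ℚ) ≠ 0 := by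
  have := ptn_Ccard nu _ rfl
  have h2 := Nat.factorial_ne_zero nu.wt
  intro h
  have h3 : zPart nu = 0 := by exact_mod_cast h
  rw [h3] at this
  omega

theorem ptn_finsum_wt {M : Type*} [AddCommMonoid M] (k : ℕ) (f : Ptn → M) :
    (∑ᶠ nu : Ptn, if nu.wt = k then f nu else 0) = ∑ nu ∈ (ptn_finite k).toFinset, f nu := by
  rw [finsum_eq_sum_of_support_subset (s := (ptn_finite k).toFinset)]
  · refine Finset.sum_congr rfl fun nu hnu => ?_
    rw [if_pos (by simpa using hnu)]
  · intro nu hnu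
    rw [Function.mem_support] at hnu
    simp only [Set.Finite.coe_toFinset, Set.mem_ofPred_eq]
    by_contra h
    rw [if_neg h] at hnu
    exact hnu rfl

/-- Vanishing identity for characters of the symmetric group: if `λ ≠ μ` are
distinct partitions of `k ≥ 1` with `P_2(λ) = P_2(μ)`, then
`Σ_{ν ⊢ k} |C_ν| χ_λ(C_ν) χ_μ(C_ν) (Σ_i ν_i³) = 0`.  The character values
`χ_ρ(C_ν)` of the irreducible representation of `𝔖_k` attached to a partition
`ρ` of `k` are characterized by the Frobenius formula
`s_ρ = Σ_{ν ⊢ k} (χ_ρ(C_ν)/z_ν) T_ν`, which is taken as the hypothesis `hchi`. -/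
theorem statement3 (k : ℕ) (hk : 1 ≤ k) (lam mu : Ptn)
    (hlam : lam.wt = k) (hmu : mu.wt = k) (hne : lam ≠ mu)
    (hP : Pfn 2 lam = Pfn 2 mu)
    (chi : Ptn → Ptn → ℚ)
    (hchi : ∀ rho : Ptn, rho.wt = k →
      schur rho = ∑ᶠ nu : Ptn,
        if nu.wt = k then (chi rho nu / (zPart nu : ℚ)) • Tmon nu else 0) :
    (∑ᶠ nu : Ptn,
      if nu.wt = k then
        ((Ccard k nu : ℚ) * chi lam nu * chi mu nu) * (∑ᶠ i : ℕ, ((nu.parts i : ℚ)) ^ 3)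
      else 0) = 0 := by
  classical
  simp only [ptn_finsum_wt] at hchi ⊢
  have hz := ptn_z_ne
  have hcoef : ∀ rho : Ptn, rho.wt = k → ∀ nu : Ptn, nu.wt = k →
      coeff (ptnE nu) (schur rho) = chi rho nu / (zPart nu : ℚ) := by
    intro rho hr nu hnu
    rw [hchi rho hr, coeff_sum, Finset.sum_eq_single nu]
    · simp [ptn_Tmon]
    · intro b _ hb
      rw [ptn_Tmon, coeff_smul, coeff_monomial, if_neg, smul_zero]
      intro h
      exact hb (ptnE_inj _ _ h)
    · intro h
      simp [hnu] at h
  have hn : ∀ n : ℕ+, ∑ nu ∈ (ptn_finite k).toFinset,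
      (chi lam nu * chi mu nu / (zPart nu : ℚ)) * ((n : ℕ) * (ptnE nu n : ℚ)) = 0 := by
    intro n
    have h := ptn_main lam mu (hlam.trans hmu.symm) hne hP n
    rw [ptnIp_adj, hchi lam hlam, map_sum, LinearMap.sum_apply] at h
    rw [← h]
    refine Finset.sum_congr rfl fun nu hnu => ?_
    have hnu : nu.wt = k := by simpa using hnu
    rw [map_smul, LinearMap.smul_apply, ptn_Tmon, ptnIp_mon, ptn_coeff_XD, ptnE_z,
      hcoef mu hmu nu hnu, smul_eq_mul]
    have := hz nu
    field_simp
  have hC : ∀ nu ∈ (ptn_finite k).toFinset, (Ccard k nu : ℚ) * chi lam nu * chi mu nu *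
      (∑ᶠ i : ℕ, ((nu.parts i : ℚ)) ^ 3) = ∑ n ∈ Finset.range k, (k.factorial : ℚ) * ((n : ℚ) + 1) ^ 2 *
      ((chi lam nu * chi mu nu / (zPart nu : ℚ)) *
        ((n.succPNat : ℕ) * (ptnE nu n.succPNat : ℚ))) := by
    intro nu hnu
    have hnu : nu.wt = k := by simpa using hnu
    rw [ptn_cube nu k hnu, Finset.mul_sum]
    refine Finset.sum_congr rfl fun n _ => ?_
    rw [← ptn_Ccard nu k hnu]
    have := hz nu
    push_cast
    rw [Nat.succPNat_coe]
    push_cast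
    field_simp
  rw [Finset.sum_congr rfl hC, Finset.sum_comm]
  refine Finset.sum_eq_zero fun n _ => ?_
  rw [← Finset.mul_sum, hn, mul_zero]
end

section
/- If λ and μ are partitions such that P_j(λ) = P_j(μ) for every integer j ≥ 1, then λ = μ. -/
theorem Pfn_eq_range (j : ℕ) (lam : Ptn) (N : ℕ) (hN : ∀ i, N ≤ i → lam.parts i = 0) :
    Pfn j lam = ∑ i ∈ Finset.range N, ((lam.parts i : ℚ) - ((i : ℚ) + 1) + 1 / 2) ^ j
      - ∑ i ∈ Finset.range N, (-((i : ℚ) + 1) + 1 / 2) ^ j := by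
  unfold Pfn
  rw [← Finset.sum_sub_distrib]
  apply finsum_eq_sum_of_support_subset
  intro i hi
  simp only [Finset.coe_range, Set.mem_Iio]
  by_contra hc
  apply hi
  simp [hN i (not_lt.mp hc)]

theorem sum_fun_eq (a b : ℕ → ℚ) (N : ℕ)
    (h : ∀ j : ℕ, ∑ i ∈ Finset.range N, a i ^ j = ∑ i ∈ Finset.range N, b i ^ j) (f : ℚ → ℚ) :
    ∑ i ∈ Finset.range N, f (a i) = ∑ i ∈ Finset.range N, f (b i) := by
  classical
  let S : Finset ℚ := (Finset.range N).image a ∪ (Finset.range N).image b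
  let p := Lagrange.interpolate S id f
  have hp : ∀ x ∈ S, f x = p.eval x := fun x hx =>
    (Lagrange.eval_interpolate_at_node (v := id) f (Function.injective_id.injOn) hx).symm
  have h1 : ∀ i ∈ Finset.range N, f (a i) = p.eval (a i) := fun i hi =>
    hp _ (Finset.mem_union_left _ (Finset.mem_image_of_mem _ hi))
  have h2 : ∀ i ∈ Finset.range N, f (b i) = p.eval (b i) := fun i hi =>
    hp _ (Finset.mem_union_right _ (Finset.mem_image_of_mem _ hi))
  rw [Finset.sum_congr rfl h1, Finset.sum_congr rfl h2]
  simp only [Polynomial.eval_eq_sum_range]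
  rw [Finset.sum_comm, Finset.sum_comm (s := Finset.range N)]
  simp only [← Finset.mul_sum, h]

theorem le_of_power_sums (a b : ℕ → ℚ) (N : ℕ) (ha : StrictAnti a) (hb : StrictAnti b)
    (h : ∀ j : ℕ, ∑ i ∈ Finset.range N, a i ^ j = ∑ i ∈ Finset.range N, b i ^ j)
    (k : ℕ) (hk : k < N) : a k ≤ b k := by
  by_contra hc
  push Not at hc
  have key := sum_fun_eq a b N h (fun x => if a k ≤ x then 1 else 0)
  simp only [Finset.sum_boole] at key
  have key' : ((Finset.range N).filter (fun i => a k ≤ a i)).card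
      = ((Finset.range N).filter (fun i => a k ≤ b i)).card := by exact_mod_cast key
  have h1 : (Finset.range (k+1)).card ≤ ((Finset.range N).filter (fun i => a k ≤ a i)).card := by
    apply Finset.card_le_card
    intro i hi
    simp only [Finset.mem_range, Finset.mem_filter] at hi ⊢
    exact ⟨by omega, ha.antitone (by omega)⟩
  have h2 : ((Finset.range N).filter (fun i => a k ≤ b i)).card ≤ (Finset.range k).card := by
    apply Finset.card_le_card
    intro i hi
    simp only [Finset.mem_range, Finset.mem_filter] at hi ⊢
    by_contra hik
    have := hb.antitone (not_lt.mp hik)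
    linarith [hi.2]
  simp only [Finset.card_range] at h1 h2
  omega

theorem strictAnti_shift (lam : Ptn) :
    StrictAnti (fun i : ℕ => (lam.parts i : ℚ) - ((i : ℚ) + 1) + 1 / 2) := by
  intro i j hij
  have h1 : (lam.parts j : ℚ) ≤ lam.parts i := by exact_mod_cast lam.antitone hij.le
  have h2 : (i : ℚ) < j := by exact_mod_cast hij
  simp only
  linarith

/-- If `P_j(λ) = P_j(μ)` for every `j ≥ 1`, then `λ = μ`. -/
theorem statement6 (lam mu : Ptn) (h : ∀ j : ℕ, 1 ≤ j → Pfn j lam = Pfn j mu) :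
    lam = mu := by
  obtain ⟨N₁, hN₁⟩ := lam.eventually_zero
  obtain ⟨N₂, hN₂⟩ := mu.eventually_zero
  have hl : ∀ i, max N₁ N₂ ≤ i → lam.parts i = 0 := fun i hi => hN₁ i (by omega)
  have hm : ∀ i, max N₁ N₂ ≤ i → mu.parts i = 0 := fun i hi => hN₂ i (by omega)
  have hs : ∀ j : ℕ, ∑ i ∈ Finset.range (max N₁ N₂),
      ((lam.parts i : ℚ) - ((i : ℚ) + 1) + 1 / 2) ^ j
      = ∑ i ∈ Finset.range (max N₁ N₂), ((mu.parts i : ℚ) - ((i : ℚ) + 1) + 1 / 2) ^ j := by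
    intro j
    rcases Nat.eq_zero_or_pos j with rfl | hj
    · simp
    · have := h j hj
      rw [Pfn_eq_range j lam _ hl, Pfn_eq_range j mu _ hm] at this
      linarith
  have hparts : lam.parts = mu.parts := by
    funext k
    by_cases hk : k < max N₁ N₂
    · have e1 := le_of_power_sums _ _ _ (strictAnti_shift lam) (strictAnti_shift mu) hs k hk
      have e2 := le_of_power_sums _ _ _ (strictAnti_shift mu) (strictAnti_shift lam)
        (fun j => (hs j).symm) k hk
      have : (lam.parts k : ℚ) = mu.parts k := by linarith
      exact_mod_cast this
    · rw [hl k (not_lt.mp hk), hm k (not_lt.mp hk)]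
  cases lam
  cases mu
  simp only at hparts
  subst hparts
  rfl
end

section
/- Let λ and μ be partitions, with the convention λ_i := 0 for i > ℓ(λ) and μ_i := 0 for i > ℓ(μ). If for every real z > 0 one has Σ_{i=1}^∞ e^{z(λ_i−i)} = Σ_{i=1}^∞ e^{z(μ_i−i)} (both series converge absolutely for z > 0), then λ = μ. -/
theorem ptn_term_le (p : Ptn) (k j : ℕ) :
    Real.exp (1 * ((p.parts (j + k) : ℝ) - (((j + k : ℕ) : ℝ) + 1))) ≤
      Real.exp ((p.parts k : ℝ) - ((k : ℝ) + 1)) * Real.exp (-1) ^ j := by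
  rw [← Real.exp_nat_mul, ← Real.exp_add]
  apply Real.exp_le_exp.mpr
  have h : (p.parts (j + k) : ℝ) ≤ p.parts k := by
    exact_mod_cast p.antitone (Nat.le_add_left k j)
  push_cast
  linarith

theorem ptn_exp_lt : Real.exp (-1) < 1 := by
  rw [Real.exp_lt_one_iff]; norm_num

theorem ptn_summable (p : Ptn) (k : ℕ) : Summable (fun j : ℕ =>
    Real.exp (1 * ((p.parts (j + k) : ℝ) - (((j + k : ℕ) : ℝ) + 1)))) :=
  Summable.of_nonneg_of_le (fun _ => (Real.exp_pos _).le) (ptn_term_le p k)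
    ((summable_geometric_of_lt_one (Real.exp_pos _).le ptn_exp_lt).mul_left _)

theorem ptn_le (lam mu : Ptn) (k : ℕ)
    (hk : ∀ i < k, lam.parts i = mu.parts i)
    (h : (∑' i : ℕ, Real.exp (1 * ((lam.parts i : ℝ) - ((i : ℝ) + 1)))) =
      (∑' i : ℕ, Real.exp (1 * ((mu.parts i : ℝ) - ((i : ℝ) + 1))))) :
    lam.parts k ≤ mu.parts k := by
  by_contra hlt
  push Not at hlt
  have h1 := (ptn_summable lam 0).sum_add_tsum_nat_add k
  have h2 := (ptn_summable mu 0).sum_add_tsum_nat_add k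
  simp only [Nat.add_zero] at h1 h2
  rw [← h1, ← h2, Finset.sum_congr rfl (fun i hi => by
    rw [hk i (Finset.mem_range.mp hi)])] at h
  have h3 := add_left_cancel h
  have h4 := (ptn_summable lam k).le_tsum 0 (fun _ _ => (Real.exp_pos _).le)
  have h5 := Summable.tsum_le_tsum (ptn_term_le mu k) (ptn_summable mu k)
    ((summable_geometric_of_lt_one (Real.exp_pos _).le ptn_exp_lt).mul_left _)
  rw [tsum_mul_left, tsum_geometric_of_lt_one (Real.exp_pos _).le ptn_exp_lt] at h5
  simp only [Nat.zero_add] at h4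
  have h6 := h4.trans (h3.le.trans h5)
  have h7 : Real.exp ((mu.parts k : ℝ) - ((k : ℝ) + 1)) * Real.exp 1 ≤
      Real.exp (1 * ((lam.parts k : ℝ) - ((k : ℝ) + 1))) := by
    rw [← Real.exp_add]
    apply Real.exp_le_exp.mpr
    have : (mu.parts k : ℝ) + 1 ≤ lam.parts k := by exact_mod_cast hlt
    linarith
  have h8 := le_of_mul_le_mul_left (h7.trans h6) (Real.exp_pos _)
  have h9 : 0 < 1 - Real.exp (-1) := by linarith [ptn_exp_lt]
  rw [← one_div, le_div_iff₀ h9, mul_sub, ← Real.exp_add] at h8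
  have := Real.exp_one_gt_d9
  norm_num at h8
  linarith

/-- If `Σ_{i≥1} e^{z(λ_i − i)} = Σ_{i≥1} e^{z(μ_i − i)}` for every real `z > 0`,
then `λ = μ`. -/
theorem statement7 (lam mu : Ptn)
    (h : ∀ z : ℝ, 0 < z →
      (∑' i : ℕ, Real.exp (z * ((lam.parts i : ℝ) - ((i : ℝ) + 1)))) =
      (∑' i : ℕ, Real.exp (z * ((mu.parts i : ℝ) - ((i : ℝ) + 1))))) :
    lam = mu := by
  have h1 := h 1 one_pos
  have key : ∀ k, lam.parts k = mu.parts k := by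
    intro k
    induction k using Nat.strong_induction_on with
    | _ k ih =>
      exact le_antisymm (ptn_le lam mu k ih h1)
        (ptn_le mu lam k (fun i hi => (ih i hi).symm) h1.symm)
  cases lam
  cases mu
  congr
  exact funext key
end

section
/- For every partition λ and every real z > 0, the series Σ_{j≥1} P_j(λ) z^j/j! converges (indeed it defines an entire function of z) and Σ_{j≥1} P_j(λ) z^j/j! = Σ_{i=1}^∞ e^{z(λ_i−i+1/2)} − 1/(2 sinh(z/2)), where the series on the right converges absolutely for z > 0 and λ_i := 0 for i > ℓ(λ). -/
theorem aux_exp (x : ℝ) :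
    HasSum (fun j : ℕ => x ^ (j + 1) / (Nat.factorial (j + 1) : ℝ)) (Real.exp x - 1) := by
  have h : HasSum (fun j : ℕ => x ^ j / (Nat.factorial j : ℝ)) (Real.exp x) := by
    rw [Real.exp_eq_exp_ℝ]
    exact NormedSpace.expSeries_div_hasSum_exp x
  have h2 := (hasSum_nat_add_iff' (f := fun j : ℕ => x ^ j / (Nat.factorial j : ℝ)) 1).mpr h
  simpa using h2

theorem aux_geom (z : ℝ) (hz : 0 < z) :
    HasSum (fun i : ℕ => Real.exp (z * (-((i : ℝ) + 1) + 1 / 2))) (1 / (2 * Real.sinh (z / 2))) := by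
  have h1 : Real.exp (-z) < 1 := by
    rw [Real.exp_lt_one_iff]; linarith
  have h := (hasSum_geometric_of_lt_one (Real.exp_pos (-z)).le h1).mul_left (Real.exp (-(z / 2)))
  convert h using 1
  · rfl
  · funext i
    rw [← Real.exp_nat_mul, ← Real.exp_add]
    congr 1
    ring
  · have hs : 0 < Real.sinh (z / 2) := Real.sinh_pos_iff.mpr (by linarith)
    have h3 : 1 - Real.exp (-z) ≠ 0 := by linarith
    rw [← div_eq_mul_inv, div_eq_div_iff (by positivity) h3, Real.sinh_eq]
    have e1 : Real.exp (-(z / 2)) * Real.exp (z / 2) = 1 := by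
      rw [← Real.exp_add]; simp
    have e2 : Real.exp (-(z / 2)) * Real.exp (-(z / 2)) = Real.exp (-z) := by
      rw [← Real.exp_add]; congr 1; ring
    linear_combination e2 - e1

theorem aux_Pfn (lam : Ptn) (N : ℕ) (hN : ∀ i : ℕ, N ≤ i → lam.parts i = 0) (j : ℕ) :
    (Pfn j lam : ℝ) = ∑ i ∈ Finset.range N,
      (((lam.parts i : ℝ) - ((i : ℝ) + 1) + 1 / 2) ^ j - (-((i : ℝ) + 1) + 1 / 2) ^ j) := by
  unfold Pfn
  rw [finsum_eq_sum_of_support_subset (s := Finset.range N)]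
  · push_cast
    rfl
  · intro i hi
    by_contra hc
    apply hi
    have : lam.parts i = 0 := hN i (by simpa using hc)
    simp [this]

/-- For every partition `λ` and every real `z > 0`, the series
`Σ_{j≥1} P_j(λ) z^j / j!` converges, the series `Σ_{i≥1} e^{z(λ_i − i + 1/2)}`
converges absolutely, and
`Σ_{j≥1} P_j(λ) z^j / j! = Σ_{i≥1} e^{z(λ_i − i + 1/2)} − 1/(2 sinh(z/2))`. -/
theorem statement8 (lam : Ptn) (z : ℝ) (hz : 0 < z) :
    Summable (fun j : ℕ => (Pfn (j + 1) lam : ℝ) * z ^ (j + 1) / (Nat.factorial (j + 1) : ℝ)) ∧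
    Summable (fun i : ℕ => Real.exp (z * ((lam.parts i : ℝ) - ((i : ℝ) + 1) + 1 / 2))) ∧
    (∑' j : ℕ, (Pfn (j + 1) lam : ℝ) * z ^ (j + 1) / (Nat.factorial (j + 1) : ℝ)) =
      (∑' i : ℕ, Real.exp (z * ((lam.parts i : ℝ) - ((i : ℝ) + 1) + 1 / 2))) -
        1 / (2 * Real.sinh (z / 2)) := by
  obtain ⟨N, hN⟩ := lam.eventually_zero
  have hA : HasSum (fun j : ℕ => (Pfn (j + 1) lam : ℝ) * z ^ (j + 1) / (Nat.factorial (j + 1) : ℝ))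
      (∑ i ∈ Finset.range N, (Real.exp (z * ((lam.parts i : ℝ) - ((i : ℝ) + 1) + 1 / 2)) -
        Real.exp (z * (-((i : ℝ) + 1) + 1 / 2)))) := by
    have h := hasSum_sum (s := Finset.range N) (fun i _ =>
      (aux_exp (z * ((lam.parts i : ℝ) - ((i : ℝ) + 1) + 1 / 2))).sub
        (aux_exp (z * (-((i : ℝ) + 1) + 1 / 2))))
    convert h using 1
    · rfl
    · funext j
      rw [aux_Pfn lam N hN, Finset.sum_mul, Finset.sum_div]
      refine Finset.sum_congr rfl fun i _ => ?_
      rw [mul_pow, mul_pow]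
      ring
    · refine Finset.sum_congr rfl fun i _ => ?_
      ring
  have hB : HasSum (fun i : ℕ => Real.exp (z * ((lam.parts i : ℝ) - ((i : ℝ) + 1) + 1 / 2)) -
        Real.exp (z * (-((i : ℝ) + 1) + 1 / 2)))
      (∑ i ∈ Finset.range N, (Real.exp (z * ((lam.parts i : ℝ) - ((i : ℝ) + 1) + 1 / 2)) -
        Real.exp (z * (-((i : ℝ) + 1) + 1 / 2)))) := by
    apply hasSum_sum_of_ne_finset_zero
    intro i hi
    have : lam.parts i = 0 := hN i (by simpa using hi)
    simp [this]
  have hC := hB.add (aux_geom z hz)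
  simp only [sub_add_cancel] at hC
  refine ⟨hA.summable, hC.summable, ?_⟩
  rw [hA.tsum_eq, hC.tsum_eq]
  ring
end

section
/- For every partition λ and every integer m ≥ 0, the m-th power sum of the contents of λ decomposes along the principal hooks as Σ_{(i,j)∈λ} (j−i)^m = Σ_{r=1}^{d} ( δ_{m,0} + Σ_{t=1}^{a_r} t^m + (−1)^m Σ_{t=1}^{b_r} t^m ), where the sum on the left runs over the cells (i,j) of the Young diagram of λ. -/
/-- `d(λ) = #{i ≥ 1 : λ_i ≥ i}`, the length of the main diagonal of the Young
diagram of `λ` (number of Frobenius coordinates). -/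
noncomputable def Ptn.dlen (lam : Ptn) : ℕ := Set.ncard {i : ℕ | i + 1 ≤ lam.parts i}

/-- The part `λ'_{r+1}` of the conjugate partition: `λ'_r = #{i ≥ 1 : λ_i ≥ r}`
(its Young diagram is the transpose of that of `λ`). -/
noncomputable def Ptn.conjParts (lam : Ptn) (r : ℕ) : ℕ :=
  Set.ncard {i : ℕ | r + 1 ≤ lam.parts i}

theorem aux_lower (S : Set ℕ) (N : ℕ) (hN : ∀ i ∈ S, i < N)
    (hS : ∀ i j : ℕ, i ≤ j → j ∈ S → i ∈ S) (i : ℕ) : i < S.ncard ↔ i ∈ S := by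
  classical
  have hex : ∃ n, n ∉ S := ⟨N, fun h => lt_irrefl _ (hN N h)⟩
  have h : S = ((Finset.range (Nat.find hex) : Finset ℕ) : Set ℕ) := by
    ext k
    simp only [Finset.coe_range, Set.mem_Iio]
    constructor
    · intro hk
      by_contra hlt
      exact Nat.find_spec hex (hS _ _ (not_lt.mp hlt) hk)
    · intro hk
      exact not_not.mp (Nat.find_min hex hk)
  have hc : S.ncard = Nat.find hex := by
    conv_lhs => rw [h]
    rw [Set.ncard_coe_finset, Finset.card_range]
  rw [hc]
  constructor
  · intro hk
    exact not_not.mp (Nat.find_min hex hk)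
  · intro hk
    by_contra hlt
    exact Nat.find_spec hex (hS _ _ (not_lt.mp hlt) hk)

theorem aux_row (f : ℕ → ℤ) (i p N : ℕ) (hp : p ≤ N) :
    (∑ j ∈ Finset.range N, if i < j ∧ j < p then f j else 0) =
      ∑ t ∈ Finset.range (p - (i + 1)), f (i + 1 + t) := by
  rw [← Finset.sum_filter, ← Finset.sum_Ico_eq_sum_range]
  apply Finset.sum_congr _ (fun _ _ => rfl)
  ext j
  simp only [Finset.mem_filter, Finset.mem_range, Finset.mem_Ico]
  omega

theorem aux_ext (f : ℕ → ℤ) (n N : ℕ) (h : n ≤ N) :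
    ∑ j ∈ Finset.range n, f j = ∑ j ∈ Finset.range N, if j < n then f j else 0 := by
  rw [← Finset.sum_filter]
  apply Finset.sum_congr _ (fun _ _ => rfl)
  ext j
  simp only [Finset.mem_filter, Finset.mem_range]
  omega

/-- Decomposition of the power sums of contents along principal hooks:
`Σ_{(i,j)∈λ} (j−i)^m = Σ_{r=1}^{d} (δ_{m,0} + Σ_{t=1}^{a_r} t^m + (−1)^m Σ_{t=1}^{b_r} t^m)`,
where `a_r = λ_r − r` and `b_r = λ'_r − r` are the Frobenius coordinates of `λ`. -/
theorem statement11 (lam : Ptn) (m : ℕ) :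
    (∑ i ∈ Finset.range lam.len, ∑ j ∈ Finset.range (lam.parts i),
      (((j : ℤ) + 1) - ((i : ℤ) + 1)) ^ m) =
    ∑ r ∈ Finset.range lam.dlen,
      ((if m = 0 then (1 : ℤ) else 0) +
       (∑ t ∈ Finset.range (lam.parts r - (r + 1)), ((t : ℤ) + 1) ^ m) +
       (-1) ^ m * ∑ t ∈ Finset.range (lam.conjParts r - (r + 1)), ((t : ℤ) + 1) ^ m) := by
  obtain ⟨M, hM⟩ := lam.eventually_zero
  have hlow : ∀ k : ℕ, 0 < k → ∀ i ∈ {i : ℕ | k ≤ lam.parts i}, i < M := by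
    intro k hk i hi
    by_contra hlt
    have := hM i (not_lt.mp hlt)
    simp only [Set.mem_setOf_eq] at hi
    omega
  have hlen : ∀ i, i < lam.len ↔ lam.parts i ≠ 0 := by
    intro i
    refine aux_lower _ M ?_ ?_ i
    · intro i hi
      exact hlow 1 one_pos i (Nat.one_le_iff_ne_zero.mpr hi)
    · intro i j hij hj
      have := lam.antitone hij
      simp only [Set.mem_setOf_eq] at hj ⊢
      omega
  have hd : ∀ i, i < lam.dlen ↔ i + 1 ≤ lam.parts i := by
    intro i
    refine aux_lower _ M ?_ ?_ i
    · intro i hi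
      exact hlow (i + 1) (Nat.succ_pos _) i hi
    · intro i j hij hj
      have := lam.antitone hij
      simp only [Set.mem_setOf_eq] at hj ⊢
      omega
  have hc : ∀ r i, i < lam.conjParts r ↔ r + 1 ≤ lam.parts i := by
    intro r i
    refine aux_lower _ M ?_ ?_ i
    · exact hlow (r + 1) (Nat.succ_pos _)
    · intro i j hij hj
      have := lam.antitone hij
      simp only [Set.mem_setOf_eq] at hj ⊢
      omega
  clear hlow
  have hlM : lam.len ≤ M := by
    by_contra hlt
    exact (hlen M).mp (not_le.mp hlt) (hM M le_rfl)
  have hdM : lam.dlen ≤ M := by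
    by_contra hlt
    have := (hd M).mp (not_le.mp hlt)
    have := hM M le_rfl
    omega
  have hcM : ∀ r, lam.conjParts r ≤ M := by
    intro r
    by_contra hlt
    have := (hc r M).mp (not_le.mp hlt)
    have := hM M le_rfl
    omega
  obtain ⟨N, hMN, hpN⟩ : ∃ N, M ≤ N ∧ lam.parts 0 ≤ N :=
    ⟨max M (lam.parts 0), le_max_left _ _, le_max_right _ _⟩
  have hp : ∀ i, lam.parts i ≤ N := fun i => (lam.antitone (Nat.zero_le i)).trans hpN
  have hL : (∑ i ∈ Finset.range lam.len, ∑ j ∈ Finset.range (lam.parts i),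
      (((j : ℤ) + 1) - ((i : ℤ) + 1)) ^ m) =
      ∑ i ∈ Finset.range N, ∑ j ∈ Finset.range N,
        ((if j = i then (if i < lam.dlen then (0 : ℤ) ^ m else 0) else 0) +
        (if i < j ∧ j < lam.parts i then ((j : ℤ) - i) ^ m else 0) +
        (if j < i ∧ i < lam.conjParts j then ((j : ℤ) - i) ^ m else 0)) := by
    rw [aux_ext _ _ N (hlM.trans hMN)]
    refine Finset.sum_congr rfl fun i _ => ?_
    have h1 : (if i < lam.len then ∑ j ∈ Finset.range (lam.parts i),
        (((j : ℤ) + 1) - ((i : ℤ) + 1)) ^ m else 0) = ∑ j ∈ Finset.range (lam.parts i),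
        (((j : ℤ) + 1) - ((i : ℤ) + 1)) ^ m := by
      split_ifs with h
      · rfl
      · have : lam.parts i = 0 := by
          by_contra h0
          exact h ((hlen i).mpr h0)
        rw [this]
        simp
    rw [h1, aux_ext _ _ N (hp i)]
    refine Finset.sum_congr rfl fun j _ => ?_
    have e : ((j : ℤ) + 1) - ((i : ℤ) + 1) = (j : ℤ) - i := by ring
    rw [e]
    have h2 := hd i
    have h3 := hc j i
    rcases lt_trichotomy i j with h | h | h
    · have a1 : ¬ j = i := by omega
      have a2 : ¬ j < i := by omega
      simp [h, a1, a2]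
    · subst h
      by_cases h4 : i < lam.parts i
      · have h5 := h2.mpr h4
        simp [h4, h5]
      · have h5 : ¬ i < lam.dlen := fun q => h4 (h2.mp q)
        simp [h4, h5]
    · have a1 : ¬ j = i := by omega
      have a2 : ¬ i < j := by omega
      have a3 : (i < lam.conjParts j) = (j < lam.parts i) := propext h3
      simp [h, a1, a2, a3]
  rw [hL, aux_ext _ _ N (hdM.trans hMN)]
  simp only [Finset.sum_add_distrib]
  rw [Finset.sum_comm (f := fun i j : ℕ =>
    if j < i ∧ i < lam.conjParts j then ((j : ℤ) - i) ^ m else 0)]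
  rw [← Finset.sum_add_distrib, ← Finset.sum_add_distrib]
  refine Finset.sum_congr rfl fun r hr => ?_
  rw [Finset.sum_ite_eq' (Finset.range N) r, if_pos hr,
    aux_row (fun j : ℕ => ((j : ℤ) - r) ^ m) r _ N (hp r),
    aux_row (fun i : ℕ => ((r : ℤ) - i) ^ m) r _ N ((hcM r).trans hMN)]
  have t1 : ∀ t : ℕ, (((r + 1 + t : ℕ) : ℤ) - r) ^ m = ((t : ℤ) + 1) ^ m := by
    intro t
    congr 1
    push_cast
    ring
  have t2 : ∀ t : ℕ, ((r : ℤ) - ((r + 1 + t : ℕ) : ℤ)) ^ m = (-1) ^ m * ((t : ℤ) + 1) ^ m := by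
    intro t
    rw [← mul_pow]
    congr 1
    push_cast
    ring
  simp only [t1, t2, ← Finset.mul_sum]
  split_ifs with h h0 h0
  · simp [h0]
  · simp [h0]
  all_goals
    have q1 : lam.parts r - (r + 1) = 0 := by
      have := hd r
      omega
    have q2 : lam.conjParts r - (r + 1) = 0 := by
      have := hd r
      have := hc r r
      omega
    simp [q1, q2]
end
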